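/- arXiv:1304.3922 — 3 statements merged into one kernel-verified Lean document; each statement's English description precedes it below -/
import Mathlib

section
/- For every nonzero integer j with 2j(2j+1) > 0 not a perfect square, ψ_4(√(2j(2j+1))) = ((75j² + 46j + 6)/(8j+3)) · π⁴/180. -/
open Real

namespace SecZeta

/-- A function with local periods `1` and `e` on an interval of length `1 + e`. -/
lemma const_of_periods (D : ℝ → ℝ) (hD : Continuous D) (e : ℝ) (he : 0 < e) (he1 : 1 ≤ e)
    (hirr : Irrational e)
    (L : ℝ) (hL : 2 * L = 1 + e)
    (h1 : ∀ x, -L ≤ x → x ≤ L - 1 → D (x + 1) = D x)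
    (h2 : ∀ x, -L ≤ x → x ≤ L - e → D (x + e) = D x)
    (x : ℝ) (hx1 : -L < x) (hx2 : x < L) : D x = D 0 := by
  let E : ℝ → ℝ := fun y => D (toIcoMod he (-L) y)
  have hE : ∀ y, E (y + e) = E y := fun y => by simp [E]
  have hED : ∀ y, -L ≤ y → y < L → E y = D y := by
    intro y hy1 hy2
    by_cases h : y < -L + e
    · have : toIcoMod he (-L) y = y := (toIcoMod_eq_self he).2 ⟨hy1, h⟩
      simp [E, this]
    · push Not at h
      -- y - e lies in the fundamental interval
      have h3 : toIcoMod he (-L) (y - e) = y - e :=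
        (toIcoMod_eq_self he).2 ⟨by linarith, by linarith⟩
      have h4 : E y = E (y - e) := by rw [← hE (y - e)]; simp
      rw [h4]
      change D (toIcoMod he (-L) (y - e)) = _
      rw [h3, ← h2 (y - e) (by linarith) (by linarith)]
      simp
  have hE1 : ∀ y, E (y + 1) = E y := by
    intro y
    have hm := toIcoMod_mem_Ico he (-L) y
    have hy : y = toIcoMod he (-L) y + toIcoDiv he (-L) y • e :=
      (toIcoMod_add_toIcoDiv_zsmul he (-L) y).symm
    have hz : ∀ (n : ℤ) (t : ℝ), E (t + n • e) = E t := fun n t => by simp [E]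
    set t := toIcoMod he (-L) y
    set n := toIcoDiv he (-L) y
    have : y + 1 = (t + 1) + n • e := by rw [hy]; ring
    rw [this, hz, hy, hz, hED _ (by linarith [hm.1]) (by linarith [hm.2]),
      hED _ hm.1 (by linarith [hm.2]), h1 _ hm.1 (by linarith [hm.2])]
  have hG : ∀ g ∈ AddSubgroup.closure ({e, 1} : Set ℝ), ∀ y, E (y + g) = E y := by
    intro g hg
    induction hg using AddSubgroup.closure_induction with
    | mem g hg =>
      rcases hg with rfl | rfl
      · exact hE
      · exact hE1
    | zero => simp
    | add a b _ _ ha hb => intro y; rw [← add_assoc, hb, ha]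
    | neg a _ ha => intro y; rw [← ha (y + -a)]; simp
  have hdense : Dense (AddSubgroup.closure ({e, 1} : Set ℝ) : Set ℝ) :=
    dense_addSubgroupClosure_pair_iff.2 (by simpa using hirr)
  by_contra hne
  have ho : IsOpen {y : ℝ | D y ≠ D 0 ∧ -L < y ∧ y < L} := by
    apply (isOpen_ne_fun hD continuous_const).inter
    exact isOpen_Ioo
  obtain ⟨g, hg1, hg2⟩ := hdense.exists_mem_open ho ⟨x, hne, hx1, hx2⟩
  apply hg2.1
  have := hG g hg1 0
  rw [zero_add, hED g hg2.2.1.le hg2.2.2, hED 0 (by linarith) (by linarith)] at this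
  exact this

lemma bern4 (y : ℝ) (hy : y ∈ Set.Icc (0 : ℝ) 1) :
    HasSum (fun n : ℕ => 1 / (n : ℝ) ^ 4 * Real.cos (2 * π * n * y))
      (-(π ^ 4 / 3) * (y ^ 4 - 2 * y ^ 3 + y ^ 2 - 1 / 30)) := by
  have h := hasSum_one_div_nat_pow_mul_cos two_ne_zero hy
  convert h using 1
  have hb : (Polynomial.map (algebraMap ℚ ℝ) (Polynomial.bernoulli (2 * 2))).eval y
      = y ^ 4 - 2 * y ^ 3 + y ^ 2 - 1 / 30 := by
    have b3 : _root_.bernoulli 3 = 0 := by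
      rw [bernoulli_eq_bernoulli'_of_ne_one (by decide), bernoulli'_three]
    have b4 : _root_.bernoulli 4 = -1 / 30 := by
      rw [bernoulli_eq_bernoulli'_of_ne_one (by decide), bernoulli'_four]
    have c42 : Nat.choose 4 2 = 6 := by decide
    simp [Polynomial.bernoulli, Finset.sum_range_succ, Polynomial.eval_monomial, b3, b4,
      bernoulli_two, bernoulli_one, c42]
    ring
  rw [hb]
  simp [Nat.factorial]
  ring

/-- Lower bound for the small denominators. -/
lemma sin_lower (N : ℤ) (r : ℝ) (hr0 : 0 < r) (hr : r ^ 2 = N) (hirr : Irrational r)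
    (n : ℕ) (hn : 0 < n) :
    2 / ((4 * r + 1) * n) ≤ |Real.sin (2 * π * n * r)| := by
  set y : ℝ := 2 * n * r with hy
  have hn1 : (1 : ℝ) ≤ n := by exact_mod_cast hn
  set m : ℤ := round y
  have hm : |y - m| ≤ 1 / 2 := abs_sub_round y
  have hy0 : 0 < y := by positivity
  have hsin : |Real.sin (2 * π * n * r)| = |Real.sin (π * (y - m))| := by
    have : π * (y - m) = 2 * π * n * r - m * π := by rw [hy]; ring
    rw [this, Real.sin_sub_int_mul_pi]
    simp [abs_mul]
  have hpi := Real.pi_pos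
  have habs : |π * (y - m)| = π * |y - m| := by rw [abs_mul, abs_of_pos hpi]
  have hle : |π * (y - m)| ≤ π / 2 := by rw [habs]; nlinarith
  have hj := Real.mul_le_sin (abs_nonneg _) hle
  rw [hsin, Real.abs_sin_eq_sin_abs_of_abs_le_pi (by linarith)]
  refine le_trans ?_ hj
  rw [habs]
  have e1 : 2 / π * (π * |y - m|) = 2 * |y - m| := by field_simp
  rw [e1]
  -- the product is a nonzero integer
  have hprod : (y - m) * (y + m) = ((4 * (n : ℤ) ^ 2 * N - m ^ 2 : ℤ) : ℝ) := by
    push_cast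
    rw [← hr, hy]; ring
  have hne : (4 * (n : ℤ) ^ 2 * N - m ^ 2 : ℤ) ≠ 0 := by
    intro h0
    rw [h0] at hprod
    have hyirr : Irrational y := by
      have := hirr.natCast_mul (m := 2 * n) (by omega)
      push_cast at this
      exact this
    rcases mul_eq_zero.1 (hprod.trans (by simp)) with h | h
    · exact hyirr ⟨(m : ℚ), by push_cast; linarith⟩
    · exact hyirr ⟨(-m : ℚ), by push_cast; linarith⟩
  have h1 : (1 : ℝ) ≤ |y - m| * |y + m| := by
    rw [← abs_mul, hprod]
    exact_mod_cast Int.one_le_abs hne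
  have h2 : |y + m| ≤ (4 * r + 1) * n := by
    have := abs_le.1 hm
    rw [abs_le]
    constructor <;> nlinarith
  rw [div_le_iff₀ (by positivity)]
  nlinarith [abs_nonneg (y - m)]

/-- The auxiliary function. -/
noncomputable def S (r x : ℝ) : ℝ :=
  ∑' n : ℕ, Real.sin (2 * π * n * x) / ((n : ℝ) ^ 4 * Real.sin (2 * π * n * r))

lemma term_bound (N : ℤ) (r : ℝ) (hr0 : 0 < r) (hr : r ^ 2 = N) (hirr : Irrational r)
    (n : ℕ) (x : ℝ) :
    ‖Real.sin (2 * π * n * x) / ((n : ℝ) ^ 4 * Real.sin (2 * π * n * r))‖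
      ≤ (4 * r + 1) / 2 * (1 / (n : ℝ) ^ 3) := by
  rcases Nat.eq_zero_or_pos n with rfl | hn
  · simp
  have h := sin_lower N r hr0 hr hirr n hn
  have hn1 : (0 : ℝ) < n := by exact_mod_cast hn
  have hp : 0 < 2 / ((4 * r + 1) * n) := by positivity
  rw [norm_div, norm_mul, Real.norm_eq_abs, Real.norm_eq_abs, Real.norm_eq_abs,
    abs_of_pos (by positivity : (0 : ℝ) < (n : ℝ) ^ 4)]
  calc _ ≤ 1 / ((n : ℝ) ^ 4 * (2 / ((4 * r + 1) * n))) := by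
        gcongr
        exact Real.abs_sin_le_one _
    _ = _ := by field_simp

lemma bound_summable (r : ℝ) : Summable (fun n : ℕ => (4 * r + 1) / 2 * (1 / (n : ℝ) ^ 3)) :=
  (Real.summable_one_div_nat_pow.2 (by norm_num)).mul_left _

lemma S_summable (N : ℤ) (r : ℝ) (hr0 : 0 < r) (hr : r ^ 2 = N) (hirr : Irrational r) (x : ℝ) :
    Summable (fun n : ℕ => Real.sin (2 * π * n * x) / ((n : ℝ) ^ 4 * Real.sin (2 * π * n * r))) :=
  Summable.of_norm_bounded (bound_summable r) (fun n => term_bound N r hr0 hr hirr n x)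

lemma S_cont (N : ℤ) (r : ℝ) (hr0 : 0 < r) (hr : r ^ 2 = N) (hirr : Irrational r) :
    Continuous (S r) :=
  continuous_tsum (fun n => by fun_prop) (bound_summable r) (term_bound N r hr0 hr hirr)

lemma S_int (r x : ℝ) (m : ℤ) : S r (x + m) = S r x := by
  unfold S
  congr 1
  ext n
  have : 2 * π * n * (x + m) = 2 * π * n * x + ((n * m : ℤ) : ℝ) * (2 * π) := by push_cast; ring
  rw [this, Real.sin_add_int_mul_two_pi]

lemma S_neg (r x : ℝ) : S r (-x) = - S r x := by
  unfold S
  rw [← tsum_neg]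
  congr 1
  ext n
  rw [mul_neg, Real.sin_neg, neg_div]

lemma S_diff (N : ℤ) (r : ℝ) (hr0 : 0 < r) (hr : r ^ 2 = N) (hirr : Irrational r) (x y : ℝ)
    (m : ℤ) (hy : y ∈ Set.Icc (0 : ℝ) 1) (hxy : x + r = y + m) :
    S r (x + 2 * r) - S r x = -(2 * π ^ 4 / 3) * (y ^ 4 - 2 * y ^ 3 + y ^ 2 - 1 / 30) := by
  have h := (bern4 y hy).mul_left 2
  unfold S
  rw [← (S_summable N r hr0 hr hirr _).tsum_sub (S_summable N r hr0 hr hirr _)]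
  have : -(2 * π ^ 4 / 3) * (y ^ 4 - 2 * y ^ 3 + y ^ 2 - 1 / 30)
    = 2 * (-(π ^ 4 / 3) * (y ^ 4 - 2 * y ^ 3 + y ^ 2 - 1 / 30)) := by ring
  rw [this, ← h.tsum_eq]
  congr 1
  ext n
  rcases Nat.eq_zero_or_pos n with rfl | hn
  · simp
  have hl := sin_lower N r hr0 hr hirr n hn
  have hn1 : (0 : ℝ) < n := by exact_mod_cast hn
  have hp : 0 < 2 / ((4 * r + 1) * n) := by positivity
  have hs : Real.sin (2 * π * n * r) ≠ 0 := abs_pos.1 (lt_of_lt_of_le hp hl)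
  have hc : Real.cos (2 * π * n * y) = Real.cos (2 * π * n * (x + r)) := by
    rw [hxy]
    have : 2 * π * n * (y + m) = 2 * π * n * y + ((n * m : ℤ) : ℝ) * (2 * π) := by push_cast; ring
    rw [this, Real.cos_add_int_mul_two_pi]
  have e1 : 2 * π * n * (x + 2 * r) = 2 * π * n * (x + r) + 2 * π * n * r := by ring
  have e2 : 2 * π * n * x = 2 * π * n * (x + r) - 2 * π * n * r := by ring
  rw [hc, e1, e2, Real.sin_add, Real.sin_sub]
  field_simp
  ring

/-- The correcting polynomial. -/
noncomputable def Q (e u : ℝ) : ℝ :=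
  -(2 * π ^ 4 / 3) * (u ^ 5 / (5 * e) - (1 + e ^ 2) / (6 * e) * u ^ 3
    + (7 / (240 * e) + e / 24 + 7 * e ^ 3 / 240) * u)

lemma main_rel (k s : ℤ) (hs : s = 1 ∨ s = -1) (hk : 2 ≤ k) (r : ℝ) (hr0 : 0 < r)
    (hr : r ^ 2 = ((k ^ 2 + s * k : ℤ) : ℝ)) (hirr : Irrational r) (e : ℝ)
    (he : e = 2 * k + s + 2 * r) (x : ℝ) (hx1 : -((1 + e) / 2) < x) (hx2 : x < (1 + e) / 2) :
    S r x - e ^ 3 * S r (x / e) = Q e x := by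
  have hk' : (2 : ℝ) ≤ k := by exact_mod_cast hk
  have hs2 : (s : ℝ) ^ 2 = 1 := by rcases hs with rfl | rfl <;> norm_num
  have hs1 : (-1 : ℝ) ≤ s := by rcases hs with rfl | rfl <;> norm_num
  have he0 : 0 < e := by rw [he]; linarith
  have hinv : 1 / e = 2 * k + s - 2 * r := by
    rw [div_eq_iff he0.ne', he]
    push_cast at hr
    linear_combination (-1 : ℝ) * hs2 + 4 * hr
  obtain ⟨t, ht⟩ : ∃ t : ℤ, s = 2 * t + 1 := by
    rcases hs with rfl | rfl
    · exact ⟨0, rfl⟩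
    · exact ⟨-1, rfl⟩
  have htR : (s : ℝ) = 2 * t + 1 := by exact_mod_cast ht
  have hirre : Irrational e := by
    have h := (hirr.natCast_mul (m := 2) (by norm_num)).intCast_add (2 * k + s)
    push_cast at h
    rwa [he]
  have key := const_of_periods (fun x => S r x - e ^ 3 * S r (x / e) - Q e x) ?_ e he0
    (by rw [he]; linarith) hirre
    ((1 + e) / 2) (by ring) ?_ ?_ x hx1 hx2
  · have h0 : S r 0 = 0 := by
      have := S_neg r 0
      rw [neg_zero] at this
      linarith
    simp only [zero_div, h0] at key
    simp [Q] at key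
    simp only [Q]
    linarith
  · have := S_cont _ r hr0 hr hirr
    unfold Q
    fun_prop
  · intro x h1 h2
    have p1 : S r (x + 1) = S r x := by simpa using S_int r x 1
    have p2 : S r ((x + 1) / e) = S r (x / e - 2 * r) := by
      rw [← S_int r (x / e - 2 * r) (2 * k + s)]
      congr 1
      push_cast
      rw [add_div, hinv]; ring
    have hy : (x + 1 / 2) / e + 1 / 2 ∈ Set.Icc (0 : ℝ) 1 := by
      have a1 : -(1 / 2) ≤ (x + 1 / 2) / e := by rw [le_div_iff₀ he0]; linarith
      have a2 : (x + 1 / 2) / e ≤ 1 / 2 := by rw [div_le_iff₀ he0]; linarith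
      constructor <;> linarith
    have p3 := S_diff _ r hr0 hr hirr (x / e - 2 * r) ((x + 1 / 2) / e + 1 / 2) (-k - t - 1) hy (by
      push_cast
      have : (x + 1 / 2) / e = x / e + (1 / e) / 2 := by ring
      rw [this, hinv, htR]; ring)
    rw [sub_add_cancel] at p3
    rw [p1, p2]
    have p4 : Q e (x + 1) - Q e x = e ^ 3 * (-(2 * π ^ 4 / 3) *
        (((x + 1 / 2) / e + 1 / 2) ^ 4 - 2 * ((x + 1 / 2) / e + 1 / 2) ^ 3
          + ((x + 1 / 2) / e + 1 / 2) ^ 2 - 1 / 30)) := by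
      unfold Q
      field_simp
      ring
    rw [← p3] at p4
    linarith
  · intro x h1 h2
    have p1 : S r ((x + e) / e) = S r (x / e) := by
      rw [add_div, div_self he0.ne']; simpa using S_int r (x / e) 1
    have p2 : S r (x + e) = S r (x + 2 * r) := by
      rw [← S_int r (x + 2 * r) (2 * k + s)]
      congr 1
      push_cast
      rw [he]; ring
    have p3 := S_diff _ r hr0 hr hirr x (x + e / 2 + 1 / 2) (-k - t - 1)
      (by constructor <;> linarith) (by push_cast; rw [he, htR]; ring)
    rw [p1, p2]
    have p4 : Q e (x + e) - Q e x = -(2 * π ^ 4 / 3) *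
        ((x + e / 2 + 1 / 2) ^ 4 - 2 * (x + e / 2 + 1 / 2) ^ 3
          + (x + e / 2 + 1 / 2) ^ 2 - 1 / 30) := by
      unfold Q
      field_simp
      ring
    rw [← p3] at p4
    linarith

lemma S_half (N : ℤ) (r : ℝ) (hr0 : 0 < r) (hr : r ^ 2 = N) (hirr : Irrational r) :
    ∑' n : ℕ, 1 / Real.cos (π * (n + 1) * r) / ((n : ℝ) + 1) ^ 4 = 2 * S r (r / 2) := by
  unfold S
  rw [(S_summable N r hr0 hr hirr _).tsum_eq_zero_add]
  simp only [Nat.cast_zero, mul_zero, zero_mul, Real.sin_zero, zero_div, zero_add]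
  rw [← tsum_mul_left]
  congr 1
  ext n
  have hl := sin_lower N r hr0 hr hirr (n + 1) (by omega)
  have hn1 : (0 : ℝ) < ((n + 1 : ℕ) : ℝ) := by positivity
  have hp : 0 < 2 / ((4 * r + 1) * ((n + 1 : ℕ) : ℝ)) := by positivity
  have hs : Real.sin (2 * π * ((n + 1 : ℕ) : ℝ) * r) ≠ 0 := abs_pos.1 (lt_of_lt_of_le hp hl)
  have e1 : 2 * π * ((n + 1 : ℕ) : ℝ) * r = 2 * (π * ((n : ℝ) + 1) * r) := by push_cast; ring
  have e2 : 2 * π * ((n + 1 : ℕ) : ℝ) * (r / 2) = π * ((n : ℝ) + 1) * r := by push_cast; ring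
  rw [e1, Real.sin_two_mul] at hs
  rw [e1, e2, Real.sin_two_mul]
  have h1 : Real.sin (π * ((n : ℝ) + 1) * r) ≠ 0 := fun h => hs (by rw [h]; ring)
  have h2 : Real.cos (π * ((n : ℝ) + 1) * r) ≠ 0 := fun h => hs (by rw [h]; ring)
  push_cast
  field_simp

lemma final (k s : ℤ) (hs : s = 1 ∨ s = -1) (hk : 2 ≤ k) (hev : Even k) (r : ℝ) (hr0 : 0 < r)
    (hr : r ^ 2 = ((k ^ 2 + s * k : ℤ) : ℝ)) (hirr : Irrational r) (e : ℝ)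
    (he : e = 2 * k + s + 2 * r) :
    (1 - s * e ^ 3) * (2 * S r (r / 2)) = 2 * Q e ((k + r) / 2) := by
  have hk' : (2 : ℝ) ≤ k := by exact_mod_cast hk
  have hs2 : (s : ℝ) ^ 2 = 1 := by rcases hs with rfl | rfl <;> norm_num
  have hs1 : (-1 : ℝ) ≤ s := by rcases hs with rfl | rfl <;> norm_num
  have he0 : 0 < e := by rw [he]; linarith
  obtain ⟨l, hl⟩ := hev
  have hlR : (k : ℝ) = l + l := by exact_mod_cast hl
  have h := main_rel k s hs hk r hr0 hr hirr e he ((k + r) / 2) (by linarith) (by linarith)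
  have e1 : (k + r) / 2 = r / 2 + l := by rw [hlR]; ring
  have e2 : (k + r) / 2 / e = s * (r / 2) + ((-s * l : ℤ) : ℝ) := by
    rw [div_eq_iff he0.ne', he]
    push_cast at hr ⊢
    rw [hlR] at hr ⊢
    linear_combination (-(s : ℝ)) * hr + (-(l : ℝ) - r / 2) * hs2
  have e3 : S r (s * (r / 2)) = s * S r (r / 2) := by
    rcases hs with rfl | rfl
    · simp
    · simp [S_neg]
  rw [e2, S_int, e3] at h
  rw [← h]
  have e4 : S r ((k + r) / 2) = S r (r / 2) := by rw [e1, S_int]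
  rw [e4]; ring

end SecZeta

open SecZeta in
theorem secant_zeta_four_at_sqrt (j : ℤ) (hj : j ≠ 0)
    (hpos : 0 < 2 * j * (2 * j + 1)) (hnsq : ¬∃ m : ℤ, 2 * j * (2 * j + 1) = m ^ 2) :
    ∑' n : ℕ, 1 / Real.cos (π * (n + 1) * Real.sqrt (2 * j * (2 * j + 1))) / ((n : ℝ) + 1) ^ 4 =
      ((75 * (j : ℝ) ^ 2 + 46 * j + 6) / (8 * j + 3)) * π ^ 4 / 180 := by
  have hposR : (0 : ℝ) < 2 * j * (2 * j + 1) := by exact_mod_cast hpos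
  set r := Real.sqrt (2 * j * (2 * j + 1)) with hrdef
  have hr0 : 0 < r := Real.sqrt_pos.2 hposR
  have hr : r ^ 2 = 2 * j * (2 * j + 1) := Real.sq_sqrt hposR.le
  have hirr : Irrational r := by
    have := (irrational_sqrt_intCast_iff (z := 2 * j * (2 * j + 1))).2
      ⟨fun ⟨m, hm⟩ => hnsq ⟨m, by rw [hm]; ring⟩, hpos.le⟩
    push_cast at this
    exact this
  rw [S_half (2 * j * (2 * j + 1)) r hr0 (by push_cast; exact hr) hirr]
  have h83 : (8 * (j : ℝ) + 3) ≠ 0 := by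
    have : (8 * j + 3 : ℤ) ≠ 0 := by omega
    exact_mod_cast this
  rcases lt_or_gt_of_ne hj with hneg | hp
  · have h := final (-2 * j) (-1) (Or.inr rfl) (by omega) ⟨-j, by ring⟩ r hr0
      (by push_cast; rw [hr]; ring) hirr _ rfl
    have hjR : (j : ℝ) ≤ -1 := by exact_mod_cast (by omega : j ≤ -1)
    push_cast at h
    set e : ℝ := 2 * (-2 * j) + -1 + 2 * r with he
    have he0 : 0 < e := by rw [he]; linarith
    have hne : (1 - -1 * e ^ 3) ≠ 0 := by
      have : 0 < e ^ 3 := by positivity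
      linarith
    apply mul_left_cancel₀ hne
    rw [h]
    unfold Q
    have h83' : (j : ℝ) * 8 + 3 ≠ 0 := by rwa [mul_comm]
    field_simp
    have r3 : r ^ 3 = 2 * j * (2 * j + 1) * r := by rw [← hr]; ring
    have r4 : r ^ 4 = (2 * j * (2 * j + 1)) ^ 2 := by rw [← hr]; ring
    have r5 : r ^ 5 = (2 * j * (2 * j + 1)) ^ 2 * r := by rw [← hr]; ring
    rw [he]
    ring_nf
    simp only [hr, r3, r4, r5]
    ring
  · have h := final (2 * j) 1 (Or.inl rfl) (by omega) ⟨j, by ring⟩ r hr0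
      (by push_cast; rw [hr]; ring) hirr _ rfl
    have hjR : (1 : ℝ) ≤ j := by exact_mod_cast (by omega : 1 ≤ j)
    push_cast at h
    set e : ℝ := 2 * (2 * j) + 1 + 2 * r with he
    have he0 : 1 < e := by rw [he]; linarith
    have hne : (1 - 1 * e ^ 3) ≠ 0 := by
      have : 1 < e ^ 3 := one_lt_pow₀ he0 (by norm_num)
      linarith
    apply mul_left_cancel₀ hne
    rw [h]
    unfold Q
    field_simp
    have r3 : r ^ 3 = 2 * j * (2 * j + 1) * r := by rw [← hr]; ring
    have r4 : r ^ 4 = (2 * j * (2 * j + 1)) ^ 2 := by rw [← hr]; ring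
    have r5 : r ^ 5 = (2 * j * (2 * j + 1)) ^ 2 * r := by rw [← hr]; ring
    rw [he]
    ring_nf
    simp only [hr, r3, r4, r5]
    ring
end

section
/- For every integer j such that 8j(2j+1) is positive and not a perfect square, ψ_2(√(8j(2j+1))) = π²/6. -/
open Real

lemma sz_removable (S : Finset ℂ) : ∀ (U : Set ℂ) (f : ℂ → ℂ), IsOpen U → (∀ p ∈ S, p ∈ U) →
    DifferentiableOn ℂ f (U \ S) →
    (∀ p ∈ S, Filter.Tendsto (fun w => (w - p) * f w) (nhdsWithin p {p}ᶜ) (nhds 0)) →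
    ∃ g : ℂ → ℂ, DifferentiableOn ℂ g U ∧ ∀ w ∉ S, g w = f w := by
  classical
  induction S using Finset.induction_on with
  | empty =>
    intro U f hU _ hd _
    exact ⟨f, by simpa using hd, fun _ _ => rfl⟩
  | insert p S hp ih =>
    intro U f hU hS hd ht
    have hV : IsOpen (U \ (S : Set ℂ)) := hU.sdiff S.finite_toSet.isClosed
    have hpV : p ∈ U \ (S : Set ℂ) := ⟨hS p (by simp), by simpa using hp⟩
    have hd1 : DifferentiableOn ℂ (Function.update f p (Filter.limUnder (nhdsWithin p {p}ᶜ) f))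
        (U \ (S : Set ℂ)) := by
      apply Complex.differentiableOn_update_limUnder_of_isLittleO (hV.mem_nhds hpV)
      · refine hd.mono ?_
        rintro x ⟨⟨h1, h2⟩, h3⟩
        refine ⟨h1, ?_⟩
        simp only [Finset.coe_insert, Set.mem_insert_iff]
        rintro (h | h)
        · exact h3 h
        · exact h2 h
      · rw [Asymptotics.isLittleO_iff_tendsto']
        · have h1 := ht p (by simp)
          have h2 : Filter.Tendsto (fun w : ℂ => (w - p) * f p) (nhdsWithin p {p}ᶜ) (nhds 0) := by
            have : Filter.Tendsto (fun w : ℂ => (w - p) * f p) (nhds p) (nhds ((p - p) * f p)) :=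
              Continuous.tendsto (by fun_prop) p
            simpa using this.mono_left nhdsWithin_le_nhds
          have h3 := h1.sub h2
          simp only [sub_zero] at h3
          refine h3.congr fun w => ?_
          rw [div_inv_eq_mul]; ring
        · filter_upwards [self_mem_nhdsWithin] with w hw h
          exact absurd (inv_eq_zero.mp h) (sub_ne_zero.mpr hw)
    obtain ⟨g, hg, hgf⟩ := ih U (Function.update f p (Filter.limUnder (nhdsWithin p {p}ᶜ) f)) hU
      (fun q hq => hS q (by simp [hq])) hd1 (by
        intro q hq
        have hqp : q ≠ p := fun h => hp (h ▸ hq)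
        refine (ht q (by simp [hq])).congr' ?_
        have : ∀ᶠ w in nhds q, w ≠ p := isOpen_ne.mem_nhds hqp
        filter_upwards [nhdsWithin_le_nhds this] with w hw
        rw [Function.update_of_ne hw])
    refine ⟨g, hg, fun w hw => ?_⟩
    simp only [Finset.mem_insert, not_or] at hw
    rw [hgf w hw.2, Function.update_of_ne hw.1]

lemma sz_residue {ι : Type*} (S : Finset ι) (p r : ι → ℂ) (hinj : Function.Injective p)
    (R : ℝ) (hR : 0 < R)
    (f : ℂ → ℂ) (U : Set ℂ) (hU : IsOpen U) (hRU : Metric.closedBall 0 R ⊆ U)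
    (hS : ∀ i ∈ S, ‖p i‖ < R)
    (hd : ∀ w ∈ U, (∀ i ∈ S, w ≠ p i) → DifferentiableAt ℂ f w)
    (ht : ∀ i ∈ S, Filter.Tendsto (fun w => (w - p i) * f w) (nhdsWithin (p i) {p i}ᶜ)
      (nhds (r i))) :
    (∮ w in C(0, R), f w) = 2 * π * Complex.I * ∑ i ∈ S, r i := by
  classical
  obtain ⟨g, hg, hgf⟩ := sz_removable (S.image p) U (fun w => f w - ∑ i ∈ S, r i * (w - p i)⁻¹) hU
    (by
      intro q hq
      obtain ⟨i, hi, rfl⟩ := Finset.mem_image.mp hq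
      apply hRU
      simpa using (hS i hi).le)
    (by
      rintro w ⟨hw, hw2⟩
      have hw3 : ∀ i ∈ S, w ≠ p i := fun i hi h => hw2 (by simpa using ⟨i, hi, h.symm⟩)
      apply DifferentiableAt.differentiableWithinAt
      refine (hd w hw hw3).sub ?_
      apply DifferentiableAt.fun_sum
      intro i hi
      have := sub_ne_zero.mpr (hw3 i hi)
      fun_prop (disch := assumption))
    (by
      intro q hq
      obtain ⟨i, hi, rfl⟩ := Finset.mem_image.mp hq
      have h1 := ht i hi
      have h2 : Filter.Tendsto (fun w => (w - p i) * ∑ j ∈ S, r j * (w - p j)⁻¹)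
          (nhdsWithin (p i) {p i}ᶜ) (nhds (r i)) := by
        have : r i = ∑ j ∈ S, if j = i then r i else 0 := by simp [hi]
        rw [this]
        simp_rw [Finset.mul_sum]
        apply tendsto_finsetSum
        intro j hj
        split_ifs with hji
        · subst hji
          refine tendsto_const_nhds.congr' ?_
          filter_upwards [self_mem_nhdsWithin] with w hw
          have := sub_ne_zero.mpr hw
          field_simp
        · have hne : p i - p j ≠ 0 := sub_ne_zero.mpr fun h => hji (hinj h).symm
          have : ContinuousAt (fun w => (w - p i) * (r j * (w - p j)⁻¹)) (p i) := by
            fun_prop (disch := assumption)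
          have := this.tendsto.mono_left (nhdsWithin_le_nhds (s := {p i}ᶜ))
          simpa using this
      have h3 := h1.sub h2
      rw [sub_self] at h3
      refine h3.congr fun w => ?_
      ring)
  have hsph : ∀ w ∈ Metric.sphere (0:ℂ) R, ∀ i ∈ S, w - p i ≠ 0 := by
    intro w hw i hi h
    rw [sub_eq_zero] at h
    have := hS i hi
    rw [← h] at this
    simp at hw
    linarith
  have h0 : (∮ w in C(0, R), g w) = 0 := by
    apply Complex.circleIntegral_eq_zero_of_differentiable_on_off_countable hR.le
      (s := ∅) Set.countable_empty (hg.continuousOn.mono hRU)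
    intro z hz
    exact hg.differentiableAt (hU.mem_nhds (hRU (Metric.ball_subset_closedBall hz.1)))
  have h1 : (∮ w in C(0, R), f w) = ∮ w in C(0, R), (g w + ∑ i ∈ S, r i * (w - p i)⁻¹) := by
    apply circleIntegral.integral_congr hR.le
    intro w hw
    have : w ∉ S.image p := by
      intro h
      obtain ⟨i, hi, rfl⟩ := Finset.mem_image.mp h
      exact hsph _ hw i hi (sub_self _)
    simp only [hgf w this]
    ring
  have hci : ∀ i ∈ S, CircleIntegrable (fun w => r i * (w - p i)⁻¹) 0 R := by
    intro i hi
    apply ContinuousOn.circleIntegrable hR.le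
    intro w hw
    have := hsph w hw i hi
    apply ContinuousAt.continuousWithinAt
    fun_prop (disch := assumption)
  rw [h1, circleIntegral.integral_add, h0, zero_add]
  · rw [circleIntegral.integral_fun_sum hci, Finset.mul_sum]
    apply Finset.sum_congr rfl
    intro i hi
    rw [circleIntegral.integral_const_mul, circleIntegral.integral_sub_inv_of_mem_ball]
    · ring
    · simpa using hS i hi
  · exact ((hg.continuousOn.mono hRU).mono Metric.sphere_subset_closedBall).circleIntegrable hR.le
  · exact CircleIntegrable.fun_sum S hci

lemma sz_sin_lower (u : ℂ) (δ : ℝ) (hδ : 0 ≤ δ) (h : ∀ n : ℤ, δ ≤ ‖u - n‖) :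
    2 * δ ≤ ‖Complex.sin (π * u)‖ := by
  have h1 := h (round u.re)
  set n := round u.re
  set t : ℝ := u.re - n with ht
  have htb : |t| ≤ 1/2 := abs_sub_round u.re
  have hu : u = (n:ℂ) + (t + u.im * Complex.I) := by
    apply Complex.ext <;> simp [ht]
  have hs : ‖Complex.sin (π * u)‖ = ‖Complex.sin (π * (t + u.im * Complex.I))‖ := by
    rw [show (π:ℂ) * u = π * (t + u.im * Complex.I) + n * π by rw [hu]; simp; ring,
      Complex.sin_add, Complex.sin_int_mul_pi, mul_zero, add_zero, norm_mul]
    have : ‖Complex.cos (n * π)‖ = 1 := by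
      have := Real.abs_cos_int_mul_pi n
      rw [← Real.norm_eq_abs, ← Complex.norm_real] at this
      push_cast at this
      exact this
    rw [this, mul_one]
  rw [hs]
  have hre : Complex.sin (π * (t + u.im * Complex.I)) =
      ((Real.sin (π * t) * Real.cosh (π * u.im) : ℝ) : ℂ) +
      ((Real.cos (π * t) * Real.sinh (π * u.im) : ℝ) : ℂ) * Complex.I := by
    rw [mul_add, ← mul_assoc, Complex.sin_add_mul_I]
    push_cast; ring
  have hnorm : ‖u - n‖ ^ 2 = t ^ 2 + u.im ^ 2 := by
    rw [Complex.sq_norm, Complex.normSq_apply]; simp [ht]; ring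
  have hsq : ‖Complex.sin (π * (t + u.im * Complex.I))‖ ^ 2 =
      Real.sin (π * t) ^ 2 + Real.sinh (π * u.im) ^ 2 := by
    rw [hre, Complex.sq_norm, Complex.normSq_add_mul_I]
    have h1 := Real.cosh_sq (π * u.im)
    have h2 := Real.sin_sq_add_cos_sq (π * t)
    rw [mul_pow, mul_pow, h1]
    linear_combination Real.sinh (π * u.im) ^ 2 * h2
  have hsin : 2 * |t| ≤ |Real.sin (π * t)| := by
    have := Real.mul_abs_le_abs_sin (x := π * t) (by
      rw [abs_mul, abs_of_pos pi_pos]; nlinarith [pi_pos])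
    rw [abs_mul, abs_of_pos pi_pos] at this
    calc 2 * |t| = 2 / π * (π * |t|) := by field_simp
      _ ≤ _ := this
  have hsinh : 2 * |u.im| ≤ |Real.sinh (π * u.im)| := by
    rw [Real.abs_sinh, abs_mul, abs_of_pos pi_pos]
    have : π * |u.im| ≤ Real.sinh (π * |u.im|) := Real.self_le_sinh_iff.mpr (by positivity)
    nlinarith [pi_gt_three, abs_nonneg u.im]
  have e1 : (2 * |t|)^2 ≤ Real.sin (π * t) ^ 2 := by
    rw [← sq_abs (Real.sin _)]; gcongr
  have e2 : (2 * |u.im|)^2 ≤ Real.sinh (π * u.im) ^ 2 := by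
    rw [← sq_abs (Real.sinh _)]; gcongr
  rw [mul_pow, sq_abs] at e1 e2
  have e3 : δ ^ 2 ≤ ‖u - n‖ ^ 2 := by gcongr
  apply le_of_sq_le_sq _ (norm_nonneg _) |> fun h => h
  rw [hsq]; nlinarith

lemma sz_dioph (z : ℝ) (D : ℤ) (hz : 0 < z) (hzD : z ^ 2 = D) (hirr : Irrational z)
    (n : ℕ) (hn : 1 ≤ n) (m : ℤ) : 1 / ((2 * z + 1) * n) ≤ |n * z - m| := by
  have hn' : (1:ℝ) ≤ n := by exact_mod_cast hn
  by_cases hbig : 1 ≤ |n * z - m|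
  · refine le_trans ?_ hbig
    rw [div_le_one (by positivity)]
    nlinarith
  push Not at hbig
  have hne : (n:ℤ)^2 * D - m^2 ≠ 0 := by
    intro h
    have h1 : (n * z - m) * (n * z + m) = 0 := by
      have : ((n:ℤ)^2 * D - m^2 : ℝ) = 0 := by exact_mod_cast h
      rw [← hzD] at this
      push_cast at this
      linear_combination this
    have hirr' : Irrational (n * z) := hirr.natCast_mul (by omega)
    rcases mul_eq_zero.mp h1 with h2 | h2
    · exact hirr' ⟨m, by push_cast; linarith⟩
    · exact hirr' ⟨-m, by push_cast; linarith⟩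
  have h1 : (1:ℝ) ≤ |((n:ℤ)^2 * D - m^2 : ℤ)| := by
    exact_mod_cast Int.one_le_abs hne
  have h2 : |(((n:ℤ)^2 * D - m^2 : ℤ):ℝ)| = |n * z - m| * |n * z + m| := by
    rw [← abs_mul]; congr 1; push_cast; rw [← hzD]; ring
  have h3 : |n * z + m| ≤ (2 * z + 1) * n := by
    have : |n * z + m| ≤ |2 * (n * z)| + |n * z - m| := by
      have := abs_sub (2 * (n * z)) (n * z - m)
      rwa [show 2 * (n * z) - (n * z - m) = n * z + m by ring] at this
    rw [abs_of_pos (by positivity : 0 < 2 * (n * z))] at this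
    nlinarith
  rw [div_le_iff₀ (by positivity)]
  push_cast at h1 h2
  rw [h2] at h1
  exact h1.trans (by gcongr)

lemma sz_summable (z : ℝ) (D : ℤ) (hz : 0 < z) (hzD : z ^ 2 = D) (hirr : Irrational z) :
    Summable (fun n : ℕ => 1 / Real.cos (π * (n + 1) * z) / ((n : ℝ) + 1) ^ 2) := by
  set c : ℝ := 1 / (2 * z + 1) with hc
  have hc0 : 0 < c := by positivity
  let t : ℕ → ℝ := fun n => Int.fract ((n + 1 : ℕ) * z) - 1 / 2
  let k : ℕ → ℕ := fun n => Nat.log 2 (n + 1)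
  let q : ℕ → ℤ := fun n => ⌊t n * 2 ^ (k n) / c⌋
  have hk1 : ∀ n : ℕ, (2:ℝ) ^ (k n) ≤ n + 1 := fun n => by
    exact_mod_cast Nat.pow_log_le_self 2 (Nat.succ_ne_zero n)
  have hk2 : ∀ n : ℕ, ((n:ℝ) + 1) < 2 * 2 ^ (k n) := fun n => by
    have := Nat.lt_pow_succ_log_self (b := 2) (by norm_num) (n + 1)
    rw [pow_succ'] at this
    exact_mod_cast this
  have hdi : ∀ n : ℕ, 1 ≤ n → ∀ m : ℤ, c / n ≤ |n * z - m| := fun n hn m => by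
    have := sz_dioph z D hz hzD hirr n hn m
    rwa [hc, div_div]
  have hinj_aux : ∀ n n' : ℕ, n < n' → k n = k n' → q n = q n' → False := by
    intro n n' hlt hk hq
    have h1 := Int.abs_sub_lt_one_of_floor_eq_floor hq
    rw [hk, ← sub_div, ← sub_mul, abs_div, abs_mul, abs_of_pos hc0,
      abs_of_pos (by positivity : (0:ℝ) < 2 ^ k n'), div_lt_one hc0] at h1
    have h2 := hdi (n' - n) (by omega) (⌊((n'+1:ℕ):ℝ) * z⌋ - ⌊((n+1:ℕ):ℝ) * z⌋)
    have h3 : ((n' - n : ℕ):ℝ) * z - ((⌊((n'+1:ℕ):ℝ) * z⌋ - ⌊((n+1:ℕ):ℝ) * z⌋ : ℤ):ℝ) = -(t n - t n') := by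
      simp only [t, Int.fract]
      rw [Nat.cast_sub hlt.le]; push_cast; ring
    rw [h3, abs_neg] at h2
    have h4 : ((n' - n : ℕ):ℝ) ≤ 2 ^ k n' := by
      rw [Nat.cast_sub hlt.le]
      have a1 := hk1 n
      have a2 := hk2 n'
      rw [hk] at a1
      linarith
    have h5 : (0:ℝ) < ((n' - n : ℕ):ℝ) := by exact_mod_cast Nat.sub_pos_of_lt hlt
    rw [div_le_iff₀ h5] at h2
    have h6 : |t n - t n'| * ((n' - n : ℕ):ℝ) ≤ |t n - t n'| * 2 ^ k n' := by gcongr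
    linarith
  have hinj : Function.Injective (fun n => (k n, q n)) := by
    intro n n' h
    simp only [Prod.mk.injEq] at h
    rcases lt_trichotomy n n' with h1 | h1 | h1
    · exact (hinj_aux n n' h1 h.1 h.2).elim
    · exact h1
    · exact (hinj_aux n' n h1 h.1.symm h.2.symm).elim
  have hs1 : Summable (fun k : ℕ => (√2)⁻¹ ^ k) := by
    apply summable_geometric_of_lt_one (by positivity)
    apply inv_lt_one_of_one_lt₀
    rw [Real.lt_sqrt] <;> norm_num
  have hs2 : Summable (fun q : ℤ => (1 + |(q:ℝ)|) ^ (-(3/2:ℝ))) := by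
    have h := (Real.summable_abs_int_rpow (b := 3/2) (by norm_num))
    apply (h.add (summable_of_hasFiniteSupport (f := fun q : ℤ => if q = 0 then (1:ℝ) else 0)
      ((Set.finite_singleton (0:ℤ)).subset (by intro x; simp)))).of_nonneg_of_le
    · intro q; positivity
    · intro q
      by_cases hq : q = 0
      · subst hq; simp
      · simp only [hq, if_false, add_zero]
        apply Real.rpow_le_rpow_of_nonpos
        · positivity
        · linarith
        · norm_num
  have hs := (hs1.mul_of_nonneg hs2 (fun k => by positivity) (fun q => by positivity)).comp_injective
    hinj
  refine Summable.of_norm_bounded (hs.mul_left ((17 / (2 * c)) ^ (3/2:ℝ))) ?_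
  intro n
  simp only [Function.comp]
  have ht : c / (8 * 2 ^ k n) ≤ |t n| := by
    have h2 := hdi (2 * (n + 1)) (by omega) (2 * ⌊((n+1:ℕ):ℝ) * z⌋ + 1)
    have h3 : ((2 * (n + 1) : ℕ):ℝ) * z - ((2 * ⌊((n+1:ℕ):ℝ) * z⌋ + 1 : ℤ):ℝ) = 2 * t n := by
      simp only [t, Int.fract]; push_cast; ring
    rw [h3, abs_mul, abs_two] at h2
    have h4 : c / (8 * 2 ^ k n) ≤ c / ((2 * (n + 1) : ℕ):ℝ) / 2 := by
      rw [div_div c]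
      apply div_le_div_of_nonneg_left hc0.le (by positivity)
      push_cast
      linarith [hk2 n]
    linarith
  have htpos : 0 < |t n| := lt_of_lt_of_le (by positivity) ht
  have hq : 1 + |(q n : ℝ)| ≤ 17 * (|t n| * 2 ^ k n / c) := by
    have h1 : |(q n : ℝ)| ≤ |t n| * 2 ^ k n / c + 1 := by
      have e : |t n| * 2 ^ k n / c = |t n * 2 ^ k n / c| := by
        rw [abs_div, abs_mul, abs_of_pos hc0, abs_of_pos (by positivity : (0:ℝ) < 2 ^ k n)]
      rw [e]
      have a1 := Int.floor_le (t n * 2 ^ k n / c)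
      have a2 := Int.lt_floor_add_one (t n * 2 ^ k n / c)
      have a3 := neg_abs_le (t n * 2 ^ k n / c)
      have a4 := le_abs_self (t n * 2 ^ k n / c)
      rw [abs_le]; constructor <;> simp only [q] <;> linarith
    have h2 : 1 / 8 ≤ |t n| * 2 ^ k n / c := by
      rw [div_le_iff₀ (by positivity)] at ht
      rw [le_div_iff₀ hc0]; linarith
    linarith
  have hcos : 2 * |t n| ≤ |Real.cos (π * (n + 1) * z)| := by
    have e : Real.cos (π * (n + 1) * z) =
        (-1) ^ ⌊((n+1:ℕ):ℝ) * z⌋ * Real.cos (π * t n + π / 2) := by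
      rw [← Real.cos_add_int_mul_pi]
      congr 1
      simp only [t, Int.fract]; push_cast; ring
    rw [e, Real.cos_add_pi_div_two, abs_mul, abs_neg, abs_zpow, abs_neg, abs_one, one_zpow, one_mul]
    have htb : |t n| ≤ 1 / 2 := by
      have a1 := Int.fract_nonneg (((n + 1 : ℕ):ℝ) * z)
      have a2 := Int.fract_lt_one (((n + 1 : ℕ):ℝ) * z)
      rw [abs_le]; constructor <;> simp only [t] <;> linarith
    have := Real.mul_abs_le_abs_sin (x := π * t n) (by
      rw [abs_mul, abs_of_pos pi_pos]; nlinarith [pi_pos])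
    rw [abs_mul, abs_of_pos pi_pos] at this
    calc 2 * |t n| = 2 / π * (π * |t n|) := by field_simp
      _ ≤ _ := this
  set x := |Real.cos (π * (n + 1) * z)| with hx
  have hxpos : 0 < x := by linarith
  have hx1 : x ≤ 1 := Real.abs_cos_le_one _
  rw [norm_div, norm_div, norm_one, Real.norm_eq_abs, Real.norm_eq_abs, ← hx,
    abs_of_pos (by positivity : (0:ℝ) < (n + 1) ^ 2)]
  have b1 : 1 / x ≤ 17 / (2 * c) * 2 ^ k n * (1 + |(q n : ℝ)|)⁻¹ := by
    rw [← div_eq_mul_inv, le_div_iff₀ (by positivity), one_div, inv_mul_le_iff₀ hxpos]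
    calc 1 + |(q n : ℝ)| ≤ 17 * (|t n| * 2 ^ k n / c) := hq
      _ = (2 * |t n|) * (17 / (2 * c) * 2 ^ k n) := by field_simp
      _ ≤ _ := by gcongr
  have b2 : 1 / x ≤ (1 / x) ^ (3/2:ℝ) := by
    have : 1 ≤ 1 / x := by rw [le_div_iff₀ hxpos]; linarith
    exact Real.self_le_rpow_of_one_le this (by norm_num)
  have b3 : (1 / x) ^ (3/2:ℝ) ≤ (17 / (2 * c)) ^ (3/2:ℝ) * (2 ^ k n) ^ (3/2:ℝ) *
      (1 + |(q n : ℝ)|) ^ (-(3/2:ℝ)) := by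
    rw [Real.rpow_neg (by positivity), ← Real.inv_rpow (by positivity),
      ← Real.mul_rpow (by positivity) (by positivity),
      ← Real.mul_rpow (by positivity) (by positivity)]
    exact Real.rpow_le_rpow (by positivity) b1 (by norm_num)
  have b4 : ((2:ℝ) ^ k n) ^ (3/2:ℝ) = (2 ^ k n) ^ 2 * (√2)⁻¹ ^ k n := by
    have e1 : (√2)⁻¹ ^ k n = ((2:ℝ) ^ k n) ^ (-(1/2:ℝ)) := by
      rw [Real.rpow_neg (by positivity), ← Real.sqrt_eq_rpow, inv_pow]
      congr 1
      rw [eq_comm, Real.sqrt_eq_iff_mul_self_eq (by positivity) (by positivity), ← mul_pow]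
      norm_num
    rw [e1, ← Real.rpow_natCast _ 2, ← Real.rpow_add (by positivity)]
    norm_num
  rw [div_le_iff₀ (by positivity)]
  have b5 : ((2:ℝ) ^ k n) ^ 2 ≤ (n + 1) ^ 2 := by
    have := hk1 n
    gcongr
  calc 1 / x ≤ (17 / (2 * c)) ^ (3/2:ℝ) * ((2 ^ k n) ^ 2 * (√2)⁻¹ ^ k n) *
      (1 + |(q n : ℝ)|) ^ (-(3/2:ℝ)) := by rw [← b4]; exact b2.trans b3
    _ ≤ (17 / (2 * c)) ^ (3/2:ℝ) * ((n + 1) ^ 2 * (√2)⁻¹ ^ k n) *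
      (1 + |(q n : ℝ)|) ^ (-(3/2:ℝ)) := by gcongr
    _ = _ := by ring

lemma sz_lim_sin : Filter.Tendsto (fun x : ℂ => (x / Complex.sin x - 1) / x ^ 2)
    (nhdsWithin 0 {0}ᶜ) (nhds (1 / 6)) := by
  have h0 : Filter.Tendsto (fun x : ℂ => ‖x‖) (nhdsWithin 0 {0}ᶜ) (nhds 0) := by
    have : Filter.Tendsto (fun x : ℂ => ‖x‖) (nhds 0) (nhds ‖(0:ℂ)‖) := continuous_norm.tendsto 0
    rw [norm_zero] at this
    exact this.mono_left nhdsWithin_le_nhds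
  have hle : ∀ᶠ x : ℂ in nhdsWithin 0 {0}ᶜ, ‖x‖ ≤ 1 := by
    filter_upwards [h0.eventually (gt_mem_nhds (zero_lt_one))] with x hx using hx.le
  have h1 : Filter.Tendsto (fun x : ℂ => (x - Complex.sin x) / x ^ 3)
      (nhdsWithin 0 {0}ᶜ) (nhds (1 / 6)) := by
    rw [tendsto_iff_norm_sub_tendsto_zero]
    refine squeeze_zero' (Filter.Eventually.of_forall fun _ => norm_nonneg _) ?_ h0
    filter_upwards [hle, self_mem_nhdsWithin] with x hx hx0
    have hx0' : x ≠ 0 := hx0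
    have hb := Complex.sin_bound hx
    have e : (x - Complex.sin x) / x ^ 3 - 1 / 6 = -(Complex.sin x - (x - x ^ 3 / 6)) / x ^ 3 := by
      field_simp; ring
    rw [e, norm_div, norm_neg, norm_pow, div_le_iff₀ (by positivity)]
    refine hb.trans ?_
    have : ‖x‖ ^ 5 = ‖x‖ ^ 4 * ‖x‖ := by ring
    nlinarith [pow_nonneg (norm_nonneg x) 4, norm_nonneg x]
  have h2 : Filter.Tendsto (fun x : ℂ => Complex.sin x / x) (nhdsWithin 0 {0}ᶜ) (nhds 1) := by
    have := (Complex.hasDerivAt_sin 0).tendsto_slope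
    rw [Complex.cos_zero] at this
    refine this.congr fun x => ?_
    simp [slope_def_field]
  have h3 := h1.mul (h2.inv₀ one_ne_zero)
  simp only [inv_one, mul_one] at h3
  refine h3.congr' ?_
  filter_upwards [self_mem_nhdsWithin, h2.eventually_ne one_ne_zero] with x hx0 hs
  have hx0' : x ≠ 0 := hx0
  have : Complex.sin x ≠ 0 := fun h => hs (by rw [h, zero_div])
  field_simp

lemma sz_lim_cos : Filter.Tendsto (fun x : ℂ => (1 / Complex.cos x - 1) / x ^ 2)
    (nhdsWithin 0 {0}ᶜ) (nhds (1 / 2)) := by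
  have h0 : Filter.Tendsto (fun x : ℂ => ‖x‖) (nhdsWithin 0 {0}ᶜ) (nhds 0) := by
    have : Filter.Tendsto (fun x : ℂ => ‖x‖) (nhds 0) (nhds ‖(0:ℂ)‖) := continuous_norm.tendsto 0
    rw [norm_zero] at this
    exact this.mono_left nhdsWithin_le_nhds
  have hle : ∀ᶠ x : ℂ in nhdsWithin 0 {0}ᶜ, ‖x‖ ≤ 1 := by
    filter_upwards [h0.eventually (gt_mem_nhds (zero_lt_one))] with x hx using hx.le
  have h1 : Filter.Tendsto (fun x : ℂ => (1 - Complex.cos x) / x ^ 2)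
      (nhdsWithin 0 {0}ᶜ) (nhds (1 / 2)) := by
    rw [tendsto_iff_norm_sub_tendsto_zero]
    refine squeeze_zero' (Filter.Eventually.of_forall fun _ => norm_nonneg _) ?_ h0
    filter_upwards [hle, self_mem_nhdsWithin] with x hx hx0
    have hx0' : x ≠ 0 := hx0
    have hb := Complex.cos_bound hx
    have e : (1 - Complex.cos x) / x ^ 2 - 1 / 2 = -(Complex.cos x - (1 - x ^ 2 / 2)) / x ^ 2 := by
      field_simp; ring
    rw [e, norm_div, norm_neg, norm_pow, div_le_iff₀ (by positivity)]
    refine hb.trans ?_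
    have : ‖x‖ ^ 4 = ‖x‖ ^ 3 * ‖x‖ := by ring
    nlinarith [pow_nonneg (norm_nonneg x) 3, norm_nonneg x]
  have h2 : Filter.Tendsto (fun x : ℂ => Complex.cos x) (nhdsWithin 0 {0}ᶜ) (nhds 1) := by
    have : Filter.Tendsto Complex.cos (nhds 0) (nhds (Complex.cos 0)) :=
      Complex.continuous_cos.tendsto 0
    rw [Complex.cos_zero] at this
    exact this.mono_left nhdsWithin_le_nhds
  have h3 := h1.mul (h2.inv₀ one_ne_zero)
  simp only [inv_one, mul_one] at h3
  refine h3.congr' ?_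
  filter_upwards [self_mem_nhdsWithin, h2.eventually_ne one_ne_zero] with x hx0 hs
  have hx0' : x ≠ 0 := hx0
  field_simp

lemma sz_simple_pole (p g' : ℂ) (g h k : ℂ → ℂ) (hg : HasDerivAt g g' p) (hgp : g p = 0)
    (hg' : g' ≠ 0) (hh : ContinuousAt h p) (hk : ContinuousAt k p) :
    Filter.Tendsto (fun w => (w - p) * (h w / g w - k w)) (nhdsWithin p {p}ᶜ) (nhds (h p / g')) := by
  have h1 := (hg.tendsto_slope).inv₀ hg'
  have h2 := (hh.tendsto.mono_left (nhdsWithin_le_nhds (s := {p}ᶜ))).mul h1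
  have h3 : Filter.Tendsto (fun w => (w - p) * k w) (nhdsWithin p {p}ᶜ) (nhds ((p - p) * k p)) := by
    have : ContinuousAt (fun w => (w - p) * k w) p := by fun_prop
    exact this.tendsto.mono_left nhdsWithin_le_nhds
  have h4 := h2.sub h3
  rw [sub_self, zero_mul, sub_zero] at h4
  rw [div_eq_mul_inv]
  refine h4.congr fun w => ?_
  rw [slope_def_field, hgp, sub_zero, inv_div]
  ring

noncomputable def szF (a : ℝ) (w : ℂ) : ℂ :=
  1 / (2 * w ^ 2 * Complex.cos (π * w) * Complex.sin (π * (a * w))) - 1 / (2 * π * a) / w ^ 3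

noncomputable def szP (a : ℝ) : ℤ ⊕ ℤ → ℂ
  | Sum.inl n => n / a
  | Sum.inr k => k + 1 / 2

noncomputable def szR (a : ℝ) : ℤ ⊕ ℤ → ℂ
  | Sum.inl n => if n = 0 then π * a / 12 + π / (4 * a) else
      1 / (2 * (n / a : ℂ) ^ 2 * Complex.cos (π * (n / a))) / (π * a * Complex.cos (n * π))
  | Sum.inr k => 1 / (2 * (k + 1 / 2 : ℂ) ^ 2 * Complex.sin (π * (a * (k + 1 / 2)))) /
      (-π * Complex.sin (π * (k + 1 / 2)))

lemma sz_cos_zero (w : ℂ) (h : Complex.cos (π * w) = 0) : ∃ k : ℤ, w = k + 1 / 2 := by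
  obtain ⟨k, hk⟩ := Complex.cos_eq_zero_iff.mp h
  refine ⟨k, ?_⟩
  have : (π:ℂ) ≠ 0 := by exact_mod_cast pi_ne_zero
  apply mul_left_cancel₀ this
  rw [hk]; ring

lemma sz_sin_zero (a : ℝ) (ha : 0 < a) (w : ℂ) (h : Complex.sin (π * (a * w)) = 0) :
    ∃ n : ℤ, w = n / a := by
  obtain ⟨k, hk⟩ := Complex.sin_eq_zero_iff.mp h
  refine ⟨k, ?_⟩
  have h1 : (π:ℂ) ≠ 0 := by exact_mod_cast pi_ne_zero
  have h2 : (a:ℂ) ≠ 0 := by exact_mod_cast ha.ne'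
  rw [eq_div_iff h2]
  apply mul_left_cancel₀ h1
  linear_combination hk

lemma sz_P_ne (a : ℝ) (ha : 0 < a) (hirr : Irrational a) (n k : ℤ) : (n / a : ℂ) ≠ k + 1 / 2 := by
  intro h
  have h2 : (a:ℂ) ≠ 0 := by exact_mod_cast ha.ne'
  rw [div_eq_iff h2] at h
  have h3 : ((2 * k + 1 : ℤ):ℝ) * a = ((2 * n : ℤ) : ℝ) := by
    have : (((2 * k + 1 : ℤ):ℝ) * a : ℂ) = (((2 * n : ℤ) : ℝ):ℂ) := by
      push_cast; linear_combination -2 * h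
    exact_mod_cast this
  have h4 : Irrational (((2 * k + 1 : ℤ):ℝ) * a) := hirr.intCast_mul (by omega)
  exact h4 ⟨(2 * n : ℤ), by rw [h3]; push_cast; ring⟩

lemma sz_P_inj (a : ℝ) (ha : 0 < a) (hirr : Irrational a) : Function.Injective (szP a) := by
  have h2 : (a:ℂ) ≠ 0 := by exact_mod_cast ha.ne'
  rintro (n | k) (n' | k') h <;> simp only [szP] at h
  · rw [div_left_inj' h2] at h
    rw [show n = n' by exact_mod_cast h]
  · exact (sz_P_ne a ha hirr _ _ h).elim
  · exact (sz_P_ne a ha hirr _ _ h.symm).elim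
  · have := add_right_cancel h
    rw [show k = k' by exact_mod_cast this]

lemma sz_norm_half (k : ℤ) : ‖((k:ℂ) + 1 / 2)‖ = |(k:ℝ) + 1 / 2| := by
  rw [← Real.norm_eq_abs, ← Complex.norm_real]; push_cast; rfl

lemma sz_norm_pole (a : ℝ) (ha : 0 < a) (n : ℤ) : ‖(n / a : ℂ)‖ = |(n:ℝ)| / a := by
  rw [norm_div, Complex.norm_intCast, Complex.norm_real, Real.norm_of_nonneg ha.le]

lemma sz_tendsto (a : ℝ) (ha : 0 < a) (hirr : Irrational a) (i : ℤ ⊕ ℤ) :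
    Filter.Tendsto (fun w => (w - szP a i) * szF a w) (nhdsWithin (szP a i) {szP a i}ᶜ)
      (nhds (szR a i)) := by
  have hpi : (π:ℂ) ≠ 0 := by exact_mod_cast pi_ne_zero
  have ha' : (a:ℂ) ≠ 0 := by exact_mod_cast ha.ne'
  rcases i with n | k
  · by_cases hn : n = 0
    · subst hn
      simp only [szP, szR, if_true, Int.cast_zero, zero_div, sub_zero]
      have hm : ∀ c : ℂ, c ≠ 0 → Filter.Tendsto (fun w : ℂ => c * w) (nhdsWithin 0 {0}ᶜ)
          (nhdsWithin 0 {0}ᶜ) := by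
        intro c hc
        apply tendsto_nhdsWithin_of_tendsto_nhds_of_eventually_within
        · have : Filter.Tendsto (fun w : ℂ => c * w) (nhds 0) (nhds (c * 0)) :=
            Continuous.tendsto (by fun_prop) 0
          rw [mul_zero] at this
          exact this.mono_left nhdsWithin_le_nhds
        · filter_upwards [self_mem_nhdsWithin] with w hw
          exact mul_ne_zero hc hw
      have h1 := sz_lim_sin.comp (hm (π * a) (mul_ne_zero hpi ha'))
      have h2 := sz_lim_cos.comp (hm π hpi)
      have h3 : Filter.Tendsto (fun w : ℂ => 1 / Complex.cos (π * w)) (nhdsWithin 0 {0}ᶜ)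
          (nhds 1) := by
        have : ContinuousAt (fun w : ℂ => 1 / Complex.cos (π * w)) 0 := by
          have : Complex.cos (π * 0) ≠ 0 := by simp
          fun_prop (disch := assumption)
        have := this.tendsto.mono_left (nhdsWithin_le_nhds (s := {0}ᶜ))
        simpa using this
      have h4 := (((h1.mul h3).mul_const ((π * a : ℂ) ^ 2)).add
        (h2.mul_const ((π:ℂ) ^ 2))).mul_const (1 / (2 * π * a : ℂ))
      have e : (1 / 6 * 1 * (π * a : ℂ) ^ 2 + 1 / 2 * (π:ℂ) ^ 2) * (1 / (2 * π * a : ℂ)) =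
          π * a / 12 + π / (4 * a) := by
        field_simp; ring
      rw [e] at h4
      refine h4.congr' ?_
      filter_upwards [self_mem_nhdsWithin] with w hw
      have hw' : w ≠ 0 := hw
      simp only [Function.comp, szF]
      rw [show (π:ℂ) * (a * w) = π * a * w by ring]
      generalize Complex.sin (π * a * w) = s
      generalize Complex.cos (π * w) = c
      rw [div_eq_mul_inv _ s, one_div c, one_div (2 * w ^ 2 * c * s), mul_inv, mul_inv]
      generalize s⁻¹ = s
      generalize c⁻¹ = c
      field_simp
      ring
    · have hn' : (n:ℂ) ≠ 0 := by exact_mod_cast hn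
      simp only [szP, szR, hn, if_false]
      have hc : Complex.cos (π * (n / a)) ≠ 0 := fun h => by
        obtain ⟨k, hk⟩ := sz_cos_zero _ h
        exact sz_P_ne a ha hirr n k hk
      have hp : (n / a : ℂ) ≠ 0 := div_ne_zero hn' ha'
      have hcn : Complex.cos (n * π) ≠ 0 := by
        rw [← Complex.ofReal_intCast, ← Complex.ofReal_mul, ← Complex.ofReal_cos,
          Real.cos_int_mul_pi]
        norm_cast
        exact zpow_ne_zero _ (by norm_num)
      have hpa : π * (a * (n / a : ℂ)) = n * π := by field_simp
      have hder : HasDerivAt (fun w : ℂ => Complex.sin (π * (a * w)))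
          (π * a * Complex.cos (n * π)) (n / a) := by
        have h1 : HasDerivAt (fun w : ℂ => π * (a * w)) ((π:ℂ) * (a * 1)) (n / a) :=
          ((hasDerivAt_id _).const_mul _).const_mul _
        have := h1.csin
        rw [hpa] at this
        convert this using 1; ring
      have := sz_simple_pole (n / a) (π * a * Complex.cos (n * π))
        (fun w : ℂ => Complex.sin (π * (a * w)))
        (fun w => 1 / (2 * w ^ 2 * Complex.cos (π * w))) (fun w => 1 / (2 * π * a) / w ^ 3) hder
        (by simp only [hpa]; exact Complex.sin_int_mul_pi n)
        (mul_ne_zero (mul_ne_zero hpi ha') hcn)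
        (by
          have : 2 * (n / a : ℂ) ^ 2 * Complex.cos (π * (n / a)) ≠ 0 :=
            mul_ne_zero (mul_ne_zero two_ne_zero (pow_ne_zero _ hp)) hc
          fun_prop (disch := assumption))
        (by
          have : (n / a : ℂ) ^ 3 ≠ 0 := pow_ne_zero _ hp
          fun_prop (disch := assumption))
      refine this.congr fun w => ?_
      simp only [szF, div_div]
  · simp only [szP, szR]
    have hp : ((k:ℂ) + 1 / 2) ≠ 0 := by
      have := sz_P_ne a ha hirr 0 k
      simpa using this.symm
    have hs : Complex.sin (π * (a * (k + 1 / 2))) ≠ 0 := fun h => by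
      obtain ⟨n, hn⟩ := sz_sin_zero a ha _ h
      exact sz_P_ne a ha hirr n k hn.symm
    have hc0 : Complex.cos (π * (k + 1 / 2)) = 0 := by
      rw [Complex.cos_eq_zero_iff]; exact ⟨k, by ring⟩
    have hs1 : Complex.sin (π * (k + 1 / 2)) ≠ 0 := fun h => by
      have := Complex.sin_sq_add_cos_sq (π * (k + 1 / 2))
      rw [h, hc0] at this; norm_num at this
    have hder : HasDerivAt (fun w : ℂ => Complex.cos (π * w))
        (-π * Complex.sin (π * (k + 1 / 2))) (k + 1 / 2) := by
      have h1 : HasDerivAt (fun w : ℂ => π * w) ((π:ℂ) * 1) (k + 1 / 2) :=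
        ((hasDerivAt_id _).const_mul _)
      convert h1.ccos using 1; ring
    have := sz_simple_pole (k + 1 / 2) (-π * Complex.sin (π * (k + 1 / 2)))
      (fun w : ℂ => Complex.cos (π * w))
      (fun w => 1 / (2 * w ^ 2 * Complex.sin (π * (a * w)))) (fun w => 1 / (2 * π * a) / w ^ 3) hder
      hc0
      (mul_ne_zero (neg_ne_zero.mpr hpi) hs1)
      (by
        have : 2 * (k + 1 / 2 : ℂ) ^ 2 * Complex.sin (π * (a * (k + 1 / 2))) ≠ 0 :=
          mul_ne_zero (mul_ne_zero two_ne_zero (pow_ne_zero _ hp)) hs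
        fun_prop (disch := assumption))
      (by
        have : (k + 1 / 2 : ℂ) ^ 3 ≠ 0 := pow_ne_zero _ hp
        fun_prop (disch := assumption))
    refine this.congr fun w => ?_
    simp only [szF, div_div]
    congr 3
    ring

lemma sz_contour (a : ℝ) (ha : 0 < a) (hirr : Irrational a) (R : ℕ) (hR : 0 < R) :
    (∮ w in C(0, R), szF a w) = 2 * π * Complex.I *
      (∑ n ∈ Finset.Icc (-(⌊a * R⌋₊ : ℤ)) ⌊a * R⌋₊, szR a (Sum.inl n) +
        ∑ k ∈ Finset.Ico (-(R:ℤ)) R, szR a (Sum.inr k)) := by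
  have hR' : (0:ℝ) < R := by exact_mod_cast hR
  have hpi : (π:ℂ) ≠ 0 := by exact_mod_cast pi_ne_zero
  have ha' : (a:ℂ) ≠ 0 := by exact_mod_cast ha.ne'
  have haR : Irrational (a * R) := hirr.mul_natCast hR.ne'
  have hm1 : ∀ n : ℤ, n ∈ Finset.Icc (-(⌊a * R⌋₊ : ℤ)) ⌊a * R⌋₊ ↔ |(n:ℝ)| < a * R := by
    intro n
    rw [Finset.mem_Icc, ← abs_le, ← Int.natCast_natAbs, Nat.cast_le, Nat.le_floor_iff (by positivity)]
    have e : ((n.natAbs : ℕ):ℝ) = |(n:ℝ)| := by rw [Nat.cast_natAbs]; push_cast; rfl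
    rw [e]
    refine ⟨fun h => lt_of_le_of_ne h fun h2 => haR ⟨|n|, ?_⟩, le_of_lt⟩
    rw [← h2]; push_cast; rfl
  have hm2 : ∀ k : ℤ, k ∈ Finset.Ico (-(R:ℤ)) R ↔ |(k:ℝ) + 1 / 2| < R := by
    intro k
    rw [Finset.mem_Ico, abs_lt]
    constructor
    · rintro ⟨h1, h2⟩
      have h1' : (-(R:ℝ)) ≤ k := by exact_mod_cast h1
      have h2' : (k:ℝ) + 1 ≤ R := by exact_mod_cast h2
      constructor <;> linarith
    · rintro ⟨h1, h2⟩
      constructor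
      · have : (-(R:ℝ)) < k + 1 := by linarith
        have : (-(R:ℤ)) < k + 1 := by exact_mod_cast this
        omega
      · have : (k:ℝ) < R := by linarith
        exact_mod_cast this
  rw [← Finset.sum_disjSum]
  refine sz_residue _ (szP a) (szR a) (sz_P_inj a ha hirr) R hR' (szF a)
    ({w | Complex.cos (π * w) ≠ 0 ∧ Complex.sin (π * (a * w)) ≠ 0} ∪ Metric.ball 0 R) ?_ ?_ ?_ ?_
    (fun i _ => sz_tendsto a ha hirr i)
  · apply IsOpen.union _ Metric.isOpen_ball
    apply IsOpen.inter
    · exact isOpen_ne.preimage (f := fun w : ℂ => Complex.cos (π * w)) (by fun_prop)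
    · exact isOpen_ne.preimage (f := fun w : ℂ => Complex.sin (π * (a * w))) (by fun_prop)
  · intro w hw
    rw [mem_closedBall_zero_iff] at hw
    rcases hw.lt_or_eq with h | h
    · right; simpa using h
    · left
      refine ⟨fun h2 => ?_, fun h2 => ?_⟩
      · obtain ⟨k, rfl⟩ := sz_cos_zero _ h2
        rw [sz_norm_half] at h
        rcases abs_eq hR'.le |>.mp h with h | h
        · have : (2 * k + 1 : ℝ) = 2 * R := by linarith
          have : (2 * k + 1 : ℤ) = 2 * R := by exact_mod_cast this
          omega
        · have : (2 * k + 1 : ℝ) = -2 * R := by linarith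
          have : (2 * k + 1 : ℤ) = -2 * R := by exact_mod_cast this
          omega
      · obtain ⟨n, rfl⟩ := sz_sin_zero a ha _ h2
        rw [sz_norm_pole a ha, div_eq_iff ha.ne'] at h
        exact haR ⟨|n|, by rw [mul_comm, ← h]; push_cast; rfl⟩
  · intro i hi
    rcases i with n | k
    · rw [Finset.inl_mem_disjSum, hm1] at hi
      simp only [szP]
      rw [sz_norm_pole a ha, div_lt_iff₀ ha]; linarith
    · rw [Finset.inr_mem_disjSum, hm2] at hi
      simp only [szP]
      rwa [sz_norm_half]
  · intro w hw hwS
    have key : Complex.cos (π * w) ≠ 0 ∧ Complex.sin (π * (a * w)) ≠ 0 := by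
      rcases hw with h | h
      · exact h
      · rw [mem_ball_zero_iff] at h
        refine ⟨fun h2 => ?_, fun h2 => ?_⟩
        · obtain ⟨k, rfl⟩ := sz_cos_zero _ h2
          rw [sz_norm_half] at h
          exact hwS (Sum.inr k) (by rw [Finset.inr_mem_disjSum, hm2]; exact h) rfl
        · obtain ⟨n, rfl⟩ := sz_sin_zero a ha _ h2
          rw [sz_norm_pole a ha, div_lt_iff₀ ha] at h
          exact hwS (Sum.inl n) (by rw [Finset.inl_mem_disjSum, hm1]; linarith) rfl
    have hw0 : w ≠ 0 := by
      rintro rfl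
      exact key.2 (by simp)
    have h1 : 2 * w ^ 2 * Complex.cos (π * w) * Complex.sin (π * (a * w)) ≠ 0 :=
      mul_ne_zero (mul_ne_zero (mul_ne_zero two_ne_zero (pow_ne_zero _ hw0)) key.1) key.2
    have h2 : w ^ 3 ≠ 0 := pow_ne_zero _ hw0
    unfold szF
    fun_prop (disch := assumption)

lemma sz_bound (a δ : ℝ) (ha : 0 < a) (hδ : 0 < δ) (R : ℕ) (hR : 0 < R)
    (h : ∀ n : ℤ, δ ≤ |a * R - n|) :
    ‖∮ w in C(0, R), szF a w‖ ≤ 2 * π * (1 / (4 * δ) + 1 / (2 * π * a)) / R := by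
  have hR' : (1:ℝ) ≤ R := by exact_mod_cast hR
  have hR0 : (0:ℝ) < R := by linarith
  have := circleIntegral.norm_integral_le_of_norm_le_const (f := szF a) (c := 0) (R := R)
    (C := (1 / (4 * δ) + 1 / (2 * π * a)) / R ^ 2) (by positivity) (by
      intro w hw
      rw [mem_sphere_zero_iff_norm] at hw
      have hs : 2 * δ ≤ ‖Complex.sin (π * (a * w))‖ := by
        apply sz_sin_lower _ _ hδ.le
        intro n
        have h1 := abs_norm_sub_norm_le (a * w : ℂ) n
        rw [norm_mul, hw, Complex.norm_real, Real.norm_of_nonneg ha.le, Complex.norm_intCast] at h1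
        have := h |n|
        push_cast at this
        exact this.trans h1
      have hc : 1 ≤ ‖Complex.cos (π * w)‖ := by
        have : 2 * (1 / 2) ≤ ‖Complex.sin (π * (w + 1 / 2))‖ := by
          apply sz_sin_lower _ _ (by norm_num)
          intro n
          have h1 := abs_norm_sub_norm_le w ((n - 1 : ℤ) + 1 / 2 : ℂ)
          rw [sz_norm_half, hw] at h1
          rw [show w + 1 / 2 - n = w - ((n - 1 : ℤ) + 1 / 2 : ℂ) by push_cast; ring]
          refine le_trans ?_ h1
          have aux : ∀ m : ℤ, (1:ℝ) / 2 ≤ |(R:ℝ) - ((m:ℝ) + 1 / 2)| := by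
            intro m
            have h0 : (2 * (R:ℤ) - (2 * m + 1)) ≠ 0 := by omega
            have h1 : (1:ℝ) ≤ |(2 * (R:ℤ) - (2 * m + 1) : ℤ)| := by
              exact_mod_cast Int.one_le_abs h0
            push_cast at h1
            rw [show (2 * (R:ℝ) - (2 * m + 1)) = 2 * (R - (m + 1 / 2)) by ring, abs_mul, abs_two] at h1
            linarith
          rcases abs_choice (((n - 1 : ℤ):ℝ) + 1 / 2) with h | h
          · rw [h]; exact aux _
          · rw [h]
            have := aux (-n)
            push_cast at this ⊢
            rw [show (R:ℝ) - -((n:ℝ) - 1 + 1 / 2) = R - (-(n:ℝ) + 1 / 2) by ring]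
            exact this
        rw [show π * (w + 1 / 2) = π * w + π / 2 by ring, Complex.sin_add_pi_div_two] at this
        linarith
      unfold szF
      refine (norm_sub_le _ _).trans ?_
      rw [add_div]
      apply add_le_add
      · rw [norm_div, norm_mul, norm_mul, norm_mul, norm_pow, hw, norm_one, Complex.norm_ofNat,
          div_div]
        apply one_div_le_one_div_of_le (by positivity)
        calc 4 * δ * (R:ℝ) ^ 2 = 2 * R ^ 2 * 1 * (2 * δ) := by ring
          _ ≤ _ := by gcongr
      · have e : ‖(1 / (2 * π * a) : ℂ)‖ = 1 / (2 * π * a) := by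
          rw [show (1 / (2 * π * a) : ℂ) = ((1 / (2 * π * a) : ℝ) : ℂ) by push_cast; ring,
            Complex.norm_real, Real.norm_of_nonneg (by positivity)]
        rw [norm_div, e, norm_pow, hw]
        gcongr
        · norm_num)
  refine this.trans (le_of_eq ?_)
  field_simp

lemma sz_sum_sym (g : ℤ → ℂ) (hg : ∀ n, g (-n) = g n) (L : ℕ) :
    ∑ n ∈ Finset.Icc (-(L:ℤ)) L, g n = g 0 + 2 * ∑ i ∈ Finset.range L, g (i + 1) := by
  induction L with
  | zero => simp
  | succ L ih =>
    have : Finset.Icc (-((L + 1 : ℕ):ℤ)) ((L + 1 : ℕ):ℤ) =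
        insert (-((L:ℤ) + 1)) (insert ((L:ℤ) + 1) (Finset.Icc (-(L:ℤ)) L)) := by
      ext x; simp only [Finset.mem_insert, Finset.mem_Icc]; push_cast; omega
    rw [this, Finset.sum_insert, Finset.sum_insert, ih, Finset.sum_range_succ, hg]
    · ring
    · simp
    · simp only [Finset.mem_insert, Finset.mem_Icc]; omega

lemma sz_main (z : ℝ) (M : ℤ) (hz : 0 < z) (hM : Odd M) (hM0 : 0 < M) (hzM : z ^ 2 = M ^ 2 - 1)
    (hirr : Irrational z) :
    ∑' n : ℕ, 1 / Real.cos (π * (n + 1) * z) / ((n : ℝ) + 1) ^ 2 = π ^ 2 / 6 := by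
  have hsum := sz_summable z (M ^ 2 - 1) hz (by push_cast; exact hzM) hirr
  set T : ℕ → ℝ := fun n => 1 / Real.cos (π * (n + 1) * z) / ((n : ℝ) + 1) ^ 2 with hT
  set ψ := ∑' n, T n with hψ
  have hlim : Filter.Tendsto (fun n => ∑ i ∈ Finset.range n, T i) Filter.atTop (nhds ψ) :=
    hsum.hasSum.tendsto_sum_nat
  have hM0' : (0:ℝ) < M := by exact_mod_cast hM0
  have hzltM : z < M := by nlinarith
  set a : ℝ := M + z with hadef
  set b : ℝ := M - z with hbdef
  have ha : 0 < a := by linarith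
  have hb : 0 < b := by linarith
  have hab : a * b = 1 := by rw [hadef, hbdef]; linear_combination -hzM
  have hirra : Irrational a := hirr.intCast_add M
  have hirrb : Irrational b := hirr.intCast_sub M
  have hcos : ∀ (s : ℝ), (s = z ∨ s = -z) → ∀ n : ℤ,
      Real.cos (n * π) * Real.cos (π * (n * (M + s))) = Real.cos (π * n * z) := by
    intro s hs n
    rw [show π * (n * (M + s)) = π * n * s + (n * M : ℤ) * π by push_cast; ring,
      Real.cos_add_int_mul_pi, Real.cos_int_mul_pi, ← mul_assoc, ← zpow_add₀ (by norm_num),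
      Even.neg_one_zpow]
    · rcases hs with rfl | rfl
      · simp
      · rw [mul_neg, Real.cos_neg, one_mul]
    · rw [← mul_one_add]
      exact Even.mul_left (by rw [add_comm]; exact hM.add_one) n
  have hres : ∀ (c s : ℝ), 0 < c → (s = z ∨ s = -z) → 1 / c = M + s → ∀ L : ℕ,
      ∑ n ∈ Finset.Icc (-(L:ℤ)) L, szR c (Sum.inl n) =
        ((π * c / 12 + π / (4 * c) + c / π * ∑ i ∈ Finset.range L, T i : ℝ) : ℂ) := by
    intro c s hc hs hcs L
    rw [sz_sum_sym (fun n => szR c (Sum.inl n))]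
    · have h0 : szR c (Sum.inl 0) = ((π * c / 12 + π / (4 * c) : ℝ) : ℂ) := by
        simp [szR]
      rw [h0, Complex.ofReal_add _ (c / π * _), Finset.mul_sum, Finset.mul_sum, Complex.ofReal_sum]
      congr 1
      apply Finset.sum_congr rfl
      intro i _
      have hne : ((i:ℤ) + 1) ≠ 0 := by omega
      simp only [szR, hne, if_false]
      have e := hcos s hs (i + 1)
      rw [← hcs] at e
      have e2 : π * (((i + 1 : ℤ):ℝ) * (1 / c)) = π * (((i + 1 : ℤ):ℝ) / c) := by ring
      rw [e2] at e
      have : 2 * (1 / (2 * (((i + 1 : ℤ):ℝ) / c) ^ 2 * Real.cos (π * (((i + 1 : ℤ):ℝ) / c))) /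
          (π * c * Real.cos (((i + 1 : ℤ):ℝ) * π))) = c / π * T i := by
        simp only [hT]
        rw [show π * ((i:ℝ) + 1) * z = π * ((i + 1 : ℤ):ℝ) * z by push_cast; ring, ← e]
        generalize Real.cos (((i + 1 : ℤ):ℝ) * π) = x
        generalize Real.cos (π * (((i + 1 : ℤ):ℝ) / c)) = y
        push_cast
        have : (i:ℝ) + 1 ≠ 0 := by positivity
        simp only [div_eq_mul_inv, mul_inv]
        generalize x⁻¹ = x
        generalize y⁻¹ = y
        field_simp
      rw [← this]
      push_cast
      rfl
    · intro n
      simp only [szR, neg_eq_zero]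
      by_cases hn : n = 0
      · simp [hn]
      · simp only [hn, if_false]
        push_cast
        rw [neg_div, mul_neg, Complex.cos_neg, neg_mul (n:ℂ) π, Complex.cos_neg, neg_sq]
  have hhalf : ∀ k : ℤ, szR b (Sum.inr k) = szR a (Sum.inr k) := by
    intro k
    simp only [szR]
    have : Complex.sin (π * (b * (k + 1 / 2))) = Complex.sin (π * (a * (k + 1 / 2))) := by
      have h1 : Real.sin (π * (b * (k + 1 / 2))) = Real.sin (π * (a * (k + 1 / 2))) := by
        rw [show π * (b * (k + 1 / 2)) = ((M * (2 * k + 1) : ℤ):ℝ) * π - π * (a * (k + 1 / 2)) by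
          rw [hadef, hbdef]; push_cast; ring, Real.sin_int_mul_pi_sub, Odd.neg_one_zpow]
        · ring
        · exact hM.mul ⟨k, rfl⟩
      have := congrArg (fun x : ℝ => (x:ℂ)) h1
      push_cast at this
      exact this
    rw [this]
  set δ : ℝ := |z - round z| / 2 with hδdef
  have hδ : 0 < δ := by
    have : z - round z ≠ 0 := fun h => hirr ⟨round z, by push_cast; linarith⟩
    have := abs_pos.mpr this
    linarith
  have hRex : ∀ N : ℕ, ∃ R : ℕ, N + 1 ≤ R ∧ ∀ n : ℤ, δ ≤ |z * R - n| := by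
    intro N
    by_contra hcon
    push Not at hcon
    obtain ⟨n, hn⟩ := hcon (N + 1) le_rfl
    obtain ⟨m, hm⟩ := hcon (N + 2) (by omega)
    have h1 := round_le z (m - n)
    have h2 : z - ((m - n : ℤ):ℝ) = (z * ((N + 2 : ℕ):ℝ) - m) - (z * ((N + 1 : ℕ):ℝ) - n) := by
      push_cast; ring
    rw [h2] at h1
    have h3 := abs_sub (z * ((N + 2 : ℕ):ℝ) - m) (z * ((N + 1 : ℕ):ℝ) - n)
    linarith
  choose R hR1 hR2 using hRex
  have hRtop : Filter.Tendsto R Filter.atTop Filter.atTop :=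
    Filter.tendsto_atTop_mono (fun N => (Nat.le_succ N).trans (hR1 N)) Filter.tendsto_id
  have hRpos : ∀ N, 0 < R N := fun N => lt_of_lt_of_le (Nat.succ_pos N) (hR1 N)
  have hda : ∀ N, ∀ n : ℤ, δ ≤ |a * R N - n| := by
    intro N n
    have := hR2 N (n - M * R N)
    convert this using 2
    rw [hadef]; push_cast; ring
  have hdb : ∀ N, ∀ n : ℤ, δ ≤ |b * R N - n| := by
    intro N n
    have := hR2 N (M * R N - n)
    rw [abs_sub_comm] at this
    convert this using 2
    rw [hbdef]; push_cast; ring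
  have hRreal : Filter.Tendsto (fun N => ((R N : ℕ):ℝ)) Filter.atTop Filter.atTop :=
    tendsto_natCast_atTop_atTop.comp hRtop
  have hI : ∀ c : ℝ, 0 < c → (∀ N, ∀ n : ℤ, δ ≤ |c * R N - n|) →
      Filter.Tendsto (fun N => ∮ w in C(0, R N), szF c w) Filter.atTop (nhds 0) := by
    intro c hc hd
    apply squeeze_zero_norm (fun N => sz_bound c δ hc hδ (R N) (hRpos N) (hd N))
    exact hRreal.const_div_atTop _
  have hdiff := (hI b hb hdb).sub (hI a ha hda)
  have hfl : ∀ c : ℝ, 0 < c → Filter.Tendsto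
      (fun N => ∑ i ∈ Finset.range ⌊c * R N⌋₊, T i) Filter.atTop (nhds ψ) := by
    intro c hc
    apply hlim.comp
    exact tendsto_nat_floor_atTop.comp (hRreal.const_mul_atTop hc)
  have hinva : 1 / a = M + -z := by
    rw [div_eq_iff ha.ne', ← hab]; rw [hbdef]; ring
  have hinvb : 1 / b = M + z := by
    rw [div_eq_iff hb.ne', ← hab]
  have hval : ∀ N, (∮ w in C(0, R N), szF b w) - (∮ w in C(0, R N), szF a w) =
      2 * π * Complex.I * (((π * b / 12 + π / (4 * b) + b / π * ∑ i ∈ Finset.range ⌊b * R N⌋₊, T i)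
        - (π * a / 12 + π / (4 * a) + a / π * ∑ i ∈ Finset.range ⌊a * R N⌋₊, T i) : ℝ) : ℂ) := by
    intro N
    rw [sz_contour b hb hirrb _ (hRpos N), sz_contour a ha hirra _ (hRpos N),
      hres b z hb (Or.inl rfl) hinvb, hres a (-z) ha (Or.inr rfl) hinva,
      Finset.sum_congr rfl (fun k _ => hhalf k)]
    push_cast
    ring
  simp_rw [hval] at hdiff
  have hlim2 : Filter.Tendsto (fun N =>
      2 * π * Complex.I * (((π * b / 12 + π / (4 * b) + b / π * ∑ i ∈ Finset.range ⌊b * R N⌋₊, T i)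
        - (π * a / 12 + π / (4 * a) + a / π * ∑ i ∈ Finset.range ⌊a * R N⌋₊, T i) : ℝ) : ℂ))
      Filter.atTop (nhds (2 * π * Complex.I * (((π * b / 12 + π / (4 * b) + b / π * ψ)
        - (π * a / 12 + π / (4 * a) + a / π * ψ) : ℝ) : ℂ))) := by
    apply Filter.Tendsto.const_mul
    apply (Complex.continuous_ofReal.tendsto _).comp
    exact (((hfl b hb).const_mul _).const_add _).sub (((hfl a ha).const_mul _).const_add _)
  have heq := tendsto_nhds_unique hlim2 hdiff
  rw [sub_zero] at heq
  have h2pi : (2 * π * Complex.I : ℂ) ≠ 0 := Complex.two_pi_I_ne_zero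
  have heq2 := (mul_eq_zero.mp heq).resolve_left h2pi
  have heq3 : (π * b / 12 + π / (4 * b) + b / π * ψ)
        - (π * a / 12 + π / (4 * a) + a / π * ψ) = 0 := by exact_mod_cast heq2
  have e1 : π / (4 * b) = π / 4 * a := by
    rw [div_eq_iff (by positivity)]; linear_combination -π * hab
  have e2 : π / (4 * a) = π / 4 * b := by
    rw [div_eq_iff (by positivity)]; linear_combination -π * hab
  rw [e1, e2, hadef, hbdef] at heq3
  have hp := pi_pos
  field_simp at heq3
  have : z * (6 * ψ - π ^ 2) = 0 := by linear_combination (-1 / 16 : ℝ) * heq3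
  have := (mul_eq_zero.mp this).resolve_left hz.ne'
  linarith

theorem secant_zeta_two_fixed_value (j : ℤ)
    (hpos : 0 < 8 * j * (2 * j + 1)) (hnsq : ¬∃ m : ℤ, 8 * j * (2 * j + 1) = m ^ 2) :
    ∑' n : ℕ, 1 / Real.cos (π * (n + 1) * Real.sqrt (8 * j * (2 * j + 1))) / ((n : ℝ) + 1) ^ 2 =
      π ^ 2 / 6 := by
  have hcast : (8 * j * (2 * j + 1) : ℝ) = ((8 * j * (2 * j + 1) : ℤ) : ℝ) := by push_cast; ring
  have hposR : (0:ℝ) < 8 * j * (2 * j + 1) := by rw [hcast]; exact_mod_cast hpos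
  have hodd : Odd (4 * j + 1) := ⟨2 * j, by ring⟩
  refine sz_main _ |4 * j + 1| (Real.sqrt_pos.mpr hposR) (odd_abs.mpr hodd)
    (abs_pos.mpr (by omega)) ?_ ?_
  · rw [Real.sq_sqrt hposR.le]; push_cast; rw [sq_abs]; ring
  · rw [hcast, irrational_sqrt_intCast_iff]
    refine ⟨fun ⟨m, hm⟩ => hnsq ⟨m, by rw [hm]; ring⟩, hpos.le⟩
end

section
/- Let j and n be integers with n ≠ 0 such that 2j(2jn+1)/n > 0 and √(2j(2jn+1)/n) is irrational. Then ψ_2(√(2j(2jn+1)/n)) = (1 + 3j/n) · π²/6. -/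
open Real




open Filter Topology Metric in
theorem szg_residue {ι : Type*} [DecidableEq ι] (R : ℝ) (hR : 0 < R) (p c : ι → ℂ) (S : Finset ι) :
    ∀ (f : ℂ → ℂ), Set.InjOn p S → (∀ i ∈ S, ‖p i‖ < R) →
    (∀ w : ℂ, ‖w‖ ≤ R → (∀ i ∈ S, w ≠ p i) → DifferentiableAt ℂ f w) →
    (∀ i ∈ S, Tendsto (fun w => (w - p i) * f w) (𝓝[≠] (p i)) (𝓝 (c i))) →
    (∮ w in C(0, R), f w) = 2 * π * Complex.I * ∑ i ∈ S, c i := by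
  induction S using Finset.induction_on with
  | empty =>
    intro f _ _ hd _
    simp only [Finset.sum_empty, mul_zero]
    refine Complex.circleIntegral_eq_zero_of_differentiable_on_off_countable hR.le
      Set.countable_empty ?_ ?_
    · intro w hw
      exact (hd w (by simpa using hw) (by simp)).continuousAt.continuousWithinAt
    · intro w hw
      have : ‖w‖ < R := by simpa using hw.1
      exact hd w this.le (by simp)
  | insert s S hs ih =>
    intro f hinj hin hd hlim
    have hsR : ‖p s‖ < R := hin s (by simp)
    have hne : ∀ i ∈ S, p i ≠ p s := by
      intro i hi h
      have := hinj (by simp [hi]) (by simp) h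
      exact hs (this ▸ hi)
    set g : ℂ → ℂ := fun w => f w - c s * (w - p s)⁻¹ with hg
    set F : ℂ → ℂ := Function.update g (p s) (limUnder (𝓝[≠] (p s)) g) with hF
    -- neighbourhood
    have hopen : ∀ᶠ w in 𝓝 (p s), ‖w‖ ≤ R ∧ ∀ i ∈ S, w ≠ p i := by
      refine Filter.Eventually.and ?_ ?_
      · filter_upwards [(continuous_norm.tendsto (p s)).eventually (gt_mem_nhds hsR)] with w hw
        exact le_of_lt hw
      · rw [Filter.eventually_all_finset]
        intro i hi
        exact isOpen_ne.mem_nhds (hne i hi).symm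
    have hgd : ∀ w, ‖w‖ ≤ R → (∀ i ∈ S, w ≠ p i) → w ≠ p s → DifferentiableAt ℂ g w := by
      intro w hw h1 h2
      have := hd w hw (by
        intro i hi
        rcases Finset.mem_insert.1 hi with rfl | hi
        · exact h2
        · exact h1 i hi)
      have h3 : w - p s ≠ 0 := sub_ne_zero.2 h2
      have h4 : DifferentiableAt ℂ (fun w => c s * (w - p s)⁻¹) w := by
        fun_prop (disch := assumption)
      exact this.sub h4
    have hdiffF : ∀ w, ‖w‖ ≤ R → (∀ i ∈ S, w ≠ p i) → DifferentiableAt ℂ F w := by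
      intro w hw h1
      by_cases h2 : w = p s
      · subst h2
        have hdo := Complex.differentiableOn_update_limUnder_of_isLittleO (f := g)
          (s := {w | ‖w‖ ≤ R ∧ ∀ i ∈ S, w ≠ p i}) (c := p s) hopen ?_ ?_
        · exact (hdo _ (mem_of_mem_nhds hopen)).differentiableAt hopen
        · intro w hw
          exact (hgd w hw.1.1 hw.1.2 (by simpa using hw.2)).differentiableWithinAt
        · have e1 : (fun z => (z - p s)) =o[𝓝[≠] (p s)] (fun _ => (1:ℂ)) := by
            rw [Asymptotics.isLittleO_one_iff]
            have : Tendsto (fun z => z - p s) (𝓝 (p s)) (𝓝 (p s - p s)) :=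
              (continuous_id.sub continuous_const).tendsto _
            rw [sub_self] at this
            exact this.mono_left nhdsWithin_le_nhds
          have hl := hlim s (by simp)
          have e2 : Tendsto (fun z => (z - p s) * (g z - g (p s))) (𝓝[≠] (p s)) (𝓝 0) := by
            have e3 : Tendsto (fun z => z - p s) (𝓝[≠] (p s)) (𝓝 0) :=
              (Asymptotics.isLittleO_one_iff ℂ).1 e1
            have e4 := (hl.sub (tendsto_const_nhds (x := c s))).sub (e3.mul_const (g (p s)))
            simp only [sub_self, zero_mul] at e4
            refine e4.congr' ?_
            filter_upwards [self_mem_nhdsWithin] with z hz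
            have : z - p s ≠ 0 := sub_ne_zero.2 hz
            simp only [hg]
            field_simp
          rw [Asymptotics.isLittleO_iff_tendsto']
          · refine e2.congr ?_
            intro z
            rw [div_inv_eq_mul, mul_comm]
          · filter_upwards [self_mem_nhdsWithin] with z hz h
            exact absurd (inv_eq_zero.1 h) (sub_ne_zero.2 hz)
      · have := hgd w hw h1 h2
        refine this.congr_of_eventuallyEq ?_
        filter_upwards [isOpen_ne.mem_nhds h2] with z hz
        simp [hF, Function.update_of_ne hz]
    have hIF := ih F (hinj.mono (by simp)) (fun i hi => hin i (by simp [hi])) hdiffF ?_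
    · have hns : ∀ w ∈ sphere (0:ℂ) R, w ≠ p s := by
        rintro w hw rfl
        simp at hw
        linarith
      have hfF : (∮ w in C(0, R), f w) = ∮ w in C(0, R), (F w + c s * (w - p s)⁻¹) := by
        refine circleIntegral.integral_congr hR.le ?_
        intro w hw
        simp only [hF, Function.update_of_ne (hns w hw), hg]
        ring
      have hFc : CircleIntegrable F 0 R := by
        refine ContinuousOn.circleIntegrable hR.le ?_
        intro w hw
        refine (hdiffF w ?_ ?_).continuousAt.continuousWithinAt
        · simp at hw; exact hw.le
        · rintro i hi rfl
          have := hin i (by simp [hi])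
          simp at hw; linarith
      have hpc : CircleIntegrable (fun w => c s * (w - p s)⁻¹) 0 R := by
        refine ContinuousOn.circleIntegrable hR.le ?_
        refine continuousOn_const.mul (ContinuousOn.inv₀ (by fun_prop) ?_)
        intro w hw
        exact sub_ne_zero.2 (hns w hw)
      rw [hfF, circleIntegral.integral_add hFc hpc, circleIntegral.integral_const_mul,
        circleIntegral.integral_sub_inv_of_mem_ball (by simpa using hsR), hIF,
        Finset.sum_insert hs]
      ring
    · intro i hi
      have hl := hlim i (by simp [hi])
      have e1 : Tendsto (fun w => (w - p i) * (c s * (w - p s)⁻¹)) (𝓝[≠] (p i)) (𝓝 0) := by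
        have : ContinuousAt (fun w => (w - p i) * (c s * (w - p s)⁻¹)) (p i) := by
          have h3 : p i - p s ≠ 0 := sub_ne_zero.2 (hne i hi)
          fun_prop (disch := assumption)
        have := this.tendsto
        simp only [sub_self, zero_mul] at this
        exact this.mono_left nhdsWithin_le_nhds
      have e2 := hl.sub e1
      rw [sub_zero] at e2
      refine e2.congr' ?_
      filter_upwards [nhdsWithin_le_nhds (isOpen_ne.mem_nhds (hne i hi))] with w hw
      simp only [hF, Function.update_of_ne hw, hg]
      ring

theorem szg_norm_sin_aux (w : ℂ) (h : |w.re| ≤ 1 / 2) : 2 * ‖w‖ ≤ ‖Complex.sin (π * w)‖ := by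
  have hpi := Real.pi_pos
  have hpi3 := Real.pi_gt_three
  have e : ‖Complex.sin (π * w)‖ ^ 2 = Real.sin (π * w.re) ^ 2 + Real.sinh (π * w.im) ^ 2 := by
    rw [Complex.sin_eq]
    have h1 : ((π:ℂ) * w).re = π * w.re := by simp
    have h2 : ((π:ℂ) * w).im = π * w.im := by simp
    rw [h1, h2, Complex.sq_norm, ← Complex.ofReal_sin, ← Complex.ofReal_cos, ← Complex.ofReal_cosh,
      ← Complex.ofReal_sinh, ← Complex.ofReal_mul, ← Complex.ofReal_mul, Complex.normSq_add_mul_I]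
    have := Real.cosh_sq (π * w.im)
    have h4 := Real.sin_sq_add_cos_sq (π * w.re)
    rw [mul_pow, mul_pow, this]
    linear_combination (Real.sinh (π * w.im))^2 * h4
  have h1 : (2 * w.re) ^ 2 ≤ Real.sin (π * w.re) ^ 2 := by
    have := Real.mul_abs_le_abs_sin (x := π * w.re) (by
      rw [abs_mul, abs_of_pos hpi]; nlinarith)
    rw [abs_mul, abs_of_pos hpi] at this
    have h5 : 2 / π * (π * |w.re|) = |2 * w.re| := by rw [abs_mul]; field_simp; simp [mul_comm]
    rw [h5] at this
    exact sq_le_sq.2 this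
  have h2 : (2 * w.im) ^ 2 ≤ Real.sinh (π * w.im) ^ 2 := by
    apply sq_le_sq.2
    rw [Real.abs_sinh]
    refine le_trans ?_ (Real.self_le_sinh_iff.2 (abs_nonneg _))
    rw [abs_mul, abs_mul, abs_of_pos hpi, abs_two]
    nlinarith [abs_nonneg w.im]
  have h3 : (2 * ‖w‖) ^ 2 ≤ ‖Complex.sin (π * w)‖ ^ 2 := by
    rw [e, mul_pow, Complex.sq_norm, Complex.normSq_apply]
    nlinarith
  exact le_of_sq_le_sq h3 (norm_nonneg _) 

theorem szg_norm_sin (w : ℂ) (δ : ℝ) (h : ∀ k : ℤ, δ ≤ ‖w - k‖) :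
    2 * δ ≤ ‖Complex.sin (π * w)‖ := by
  have h1 := szg_norm_sin_aux (w - (round w.re : ℤ)) (by
    simpa using abs_sub_round w.re)
  have h2 := h (round w.re)
  have e : ‖Complex.sin (π * (w - (round w.re : ℤ)))‖ = ‖Complex.sin (π * w)‖ := by
    rw [mul_sub, mul_comm (π:ℂ) ((round w.re : ℤ) : ℂ), Complex.sin_sub, Complex.sin_int_mul_pi,
      mul_zero, sub_zero, norm_mul]
    have h3 := Complex.sin_sq_add_cos_sq (((round w.re : ℤ) : ℂ) * π)
    rw [Complex.sin_int_mul_pi] at h3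
    have h4 : ‖Complex.cos (((round w.re : ℤ) : ℂ) * π)‖ ^ 2 = 1 := by
      rw [← norm_pow, show Complex.cos (((round w.re : ℤ) : ℂ) * π) ^ 2 = 1 by linear_combination h3]
      simp
    have h5 : ‖Complex.cos (((round w.re : ℤ) : ℂ) * π)‖ = 1 := by
      nlinarith [norm_nonneg (Complex.cos (((round w.re : ℤ) : ℂ) * π))]
    rw [h5, mul_one]
  rw [e] at h1
  linarith

theorem szg_cot_bound (w : ℂ) (δ : ℝ) (hδ : 0 < δ) (h : ∀ k : ℤ, δ ≤ ‖w - k‖) :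
    ‖Complex.cot (π * w)‖ ≤ 1 + 1 / δ := by
  have h1 := szg_norm_sin w δ h
  set s := Complex.sin (π * w)
  have hs : 0 < ‖s‖ := by linarith
  have h2 : ‖Complex.cos (π * w)‖ ^ 2 ≤ (1 + ‖s‖) ^ 2 := by
    rw [← norm_pow, Complex.cos_sq']
    refine (norm_sub_le _ _).trans ?_
    simp only [norm_one, norm_pow]
    nlinarith [norm_nonneg s]
  have h3 : ‖Complex.cos (π * w)‖ ≤ 1 + ‖s‖ := le_of_sq_le_sq h2 (by positivity)
  rw [Complex.cot, norm_div, div_le_iff₀ hs]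
  have : 1 ≤ 1 / δ * ‖s‖ := by
    rw [div_mul_eq_mul_div, le_div_iff₀ hδ]; linarith
  nlinarith

theorem szg_sec_bound (w : ℂ) (δ : ℝ) (hδ : 0 < δ) (h : ∀ k : ℤ, δ ≤ ‖w + 1 / 2 - k‖) :
    ‖(Complex.cos (π * w))⁻¹‖ ≤ 1 / δ := by
  have h1 := szg_norm_sin (w + 1 / 2) δ h
  have : Complex.sin (π * (w + 1 / 2)) = Complex.cos (π * w) := by
    rw [← Complex.sin_add_pi_div_two]; congr 1; ring
  rw [this] at h1
  rw [norm_inv, inv_eq_one_div]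
  exact one_div_le_one_div_of_le hδ (by linarith)

open Filter Topology in
theorem szg_sin_div : Tendsto (fun x : ℂ => Complex.sin x / x) (𝓝[≠] 0) (𝓝 1) := by
  have := (Complex.hasDerivAt_sin 0).tendsto_slope
  rw [Complex.cos_zero] at this
  refine this.congr ?_
  intro x
  simp [slope_def_field]

open Filter Topology in
theorem szg_scale (c : ℂ) (hc : c ≠ 0) : Tendsto (fun x : ℂ => c * x) (𝓝[≠] 0) (𝓝[≠] 0) := by
  refine tendsto_nhdsWithin_iff.2 ⟨?_, ?_⟩
  · have : Tendsto (fun x : ℂ => c * x) (𝓝 0) (𝓝 (c * 0)) := by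
      apply Continuous.tendsto; fun_prop
    rw [mul_zero] at this
    exact this.mono_left nhdsWithin_le_nhds
  · filter_upwards [self_mem_nhdsWithin] with x hx
    exact mul_ne_zero hc hx

open Filter Topology in
theorem szg_cos_lim : Tendsto (fun x : ℂ => (1 - Complex.cos x) / x ^ 2) (𝓝[≠] 0) (𝓝 (1 / 2)) := by
  have := ((szg_sin_div.comp (szg_scale (1/2) (by norm_num))).pow 2).const_mul (1/2)
  simp only [one_pow, mul_one] at this
  refine this.congr' ?_
  filter_upwards [self_mem_nhdsWithin] with x hx
  have hx : x ≠ 0 := hx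
  have h1 : Complex.cos x = 1 - 2 * Complex.sin (1 / 2 * x) ^ 2 := by
    have : x = 2 * (1 / 2 * x) := by ring
    conv_lhs => rw [this]
    rw [Complex.cos_two_mul, Complex.cos_sq']; ring
  simp only [Function.comp]
  rw [h1]
  field_simp
  ring

open Filter Topology in
theorem szg_sin_lim : Tendsto (fun x : ℂ => (x - Complex.sin x) / x ^ 3) (𝓝[≠] 0) (𝓝 (1 / 6)) := by
  rw [tendsto_iff_norm_sub_tendsto_zero]
  have h0 : Tendsto (fun x : ℂ => ‖x‖ ^ 2 / 100) (𝓝[≠] 0) (𝓝 0) := by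
    have : Tendsto (fun x : ℂ => ‖x‖ ^ 2 / 100) (𝓝 0) (𝓝 (‖(0:ℂ)‖ ^ 2 / 100)) := by
      apply Continuous.tendsto; fun_prop
    simp only [norm_zero, ne_eq, OfNat.ofNat_ne_zero, not_false_eq_true, zero_pow, zero_div] at this
    exact this.mono_left nhdsWithin_le_nhds
  refine squeeze_zero' (Eventually.of_forall fun _ => norm_nonneg _) ?_ h0
  have hb : ∀ᶠ x : ℂ in 𝓝[≠] 0, ‖x‖ ≤ 1 := by
    refine nhdsWithin_le_nhds ?_
    filter_upwards [Metric.ball_mem_nhds (0:ℂ) one_pos] with x hx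
    simp at hx; exact hx.le
  filter_upwards [hb, self_mem_nhdsWithin] with x hx h0
  have h0 : x ≠ 0 := h0
  have := Complex.sin_bound hx
  have e : (x - Complex.sin x) / x ^ 3 - 1 / 6 = - (Complex.sin x - (x - x ^ 3 / 6)) / x ^ 3 := by
    field_simp; ring
  rw [e, norm_div, norm_neg, norm_pow, div_le_iff₀ (by positivity)]
  calc _ ≤ _ := this
    _ = _ := by ring

open Filter Topology in
theorem szg_cot_lim : Tendsto (fun x : ℂ => (Complex.cot x - 1 / x) / x) (𝓝[≠] 0) (𝓝 (-1 / 3)) := by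
  have := ((szg_sin_lim.sub szg_cos_lim).div szg_sin_div one_ne_zero)
  norm_num at this
  norm_num
  refine this.congr' ?_
  have hs := szg_sin_div.eventually_ne one_ne_zero
  filter_upwards [self_mem_nhdsWithin, hs] with x hx h2
  have hx : x ≠ 0 := hx
  have : Complex.sin x ≠ 0 := by
    intro h; simp [h] at h2
  simp only [Complex.cot, Pi.div_apply]
  field_simp
  ring



theorem szg_sep (z : ℝ) (hz : 0 < z) (hirr : Irrational z) (n N : ℤ) (hn : n ≠ 0)
    (hN : (n : ℝ) * z ^ 2 = N) :
    ∃ c : ℝ, 0 < c ∧ ∀ a b : ℤ, a ≠ 0 → c ≤ |(a : ℝ)| * |a * z - b| := by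
  have hn1 : (1 : ℝ) ≤ |(n : ℝ)| := by exact_mod_cast Int.one_le_abs hn
  refine ⟨1 / (|(n : ℝ)| * (2 * z + 1)), by positivity, ?_⟩
  intro a b ha
  have ha1 : (1 : ℝ) ≤ |(a : ℝ)| := by exact_mod_cast Int.one_le_abs ha
  rw [div_le_iff₀ (by positivity)]
  rcases le_or_gt 1 |a * z - b| with h | h
  · have h1 : 1 ≤ |(a : ℝ)| * |a * z - b| := by nlinarith
    have h2 : 1 ≤ |(n : ℝ)| * (2 * z + 1) := by nlinarith
    nlinarith
  · have h1 : |a * z + b| ≤ |(a : ℝ)| * (2 * z + 1) := by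
      have : a * z + b = 2 * (a * z) - (a * z - b) := by ring
      rw [this]
      refine (abs_sub _ _).trans ?_
      rw [abs_mul, abs_mul, abs_two, abs_of_pos hz]
      nlinarith
    have hne : N * a ^ 2 - n * b ^ 2 ≠ 0 := by
      intro h0
      have h0' : (N : ℝ) * a ^ 2 - n * b ^ 2 = 0 := by exact_mod_cast h0
      rw [← hN] at h0'
      have h3 : (n : ℝ) * ((a * z - b) * (a * z + b)) = 0 := by linear_combination h0'
      have hnr : (n : ℝ) ≠ 0 := by exact_mod_cast hn
      have hirr2 : Irrational (a * z) := hirr.intCast_mul ha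
      rcases mul_eq_zero.1 ((mul_eq_zero.1 h3).resolve_left hnr) with h4 | h4
      · exact hirr2.ne_int b (by linarith)
      · exact hirr2.ne_int (-b) (by push_cast; linarith)
    have h2 : (1 : ℝ) ≤ |(N : ℝ) * a ^ 2 - n * b ^ 2| := by
      exact_mod_cast Int.one_le_abs hne
    have h3 : (N : ℝ) * a ^ 2 - n * b ^ 2 = n * ((a * z - b) * (a * z + b)) := by
      rw [← hN]; ring
    rw [h3, abs_mul, abs_mul] at h2
    calc (1:ℝ) ≤ _ := h2
      _ ≤ |(n:ℝ)| * (|a * z - b| * (|(a : ℝ)| * (2 * z + 1))) := by gcongr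
      _ = _ := by ring

theorem szg_cos_lower (y : ℝ) : |2 * Int.fract y - 1| ≤ |Real.cos (π * y)| := by
  have h0 := Int.fract_nonneg y
  have h1 := (Int.fract_lt_one y).le
  have e : |Real.cos (π * y)| = |Real.sin (π * (Int.fract y - 1 / 2))| := by
    have : π * y = π * Int.fract y + ⌊y⌋ * π := by
      nth_rewrite 1 [← Int.floor_add_fract y]; ring
    rw [this, Real.cos_add_int_mul_pi, abs_mul, abs_zpow, abs_neg, abs_one, one_zpow, one_mul,
      show π * (Int.fract y - 1 / 2) = π * Int.fract y - π / 2 by ring, Real.sin_sub_pi_div_two,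
      abs_neg]
  rw [e]
  have hpi := Real.pi_pos
  have h3 : |Int.fract y - 1 / 2| ≤ 1 / 2 := by rw [abs_le]; constructor <;> linarith
  have := Real.mul_abs_le_abs_sin (x := π * (Int.fract y - 1 / 2)) (by
    rw [abs_mul, abs_of_pos hpi]; nlinarith)
  refine le_trans (le_of_eq ?_) this
  rw [abs_mul, abs_of_pos hpi, show 2 * Int.fract y - 1 = 2 * (Int.fract y - 1 / 2) by ring,
    abs_mul, abs_two]
  field_simp

theorem szg_summable_aux : Summable (fun t : ℕ × ℤ => (((2:ℝ) ^ (-(1/2) : ℝ)) ^ t.1) *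
    (1 / (1 + |(t.2 : ℝ)|) ^ (3 / 2 : ℝ))) := by
  have h1 : Summable (fun i : ℕ => ((2:ℝ) ^ (-(1/2) : ℝ)) ^ i) :=
    summable_geometric_of_lt_one (by positivity)
      (Real.rpow_lt_one_of_one_lt_of_neg (by norm_num) (by norm_num))
  have h2 : Summable (fun q : ℤ => 1 / (1 + |(q : ℝ)|) ^ (3 / 2 : ℝ)) := by
    refine Summable.of_nonneg_of_le (fun q => by positivity) ?_
      ((Real.summable_one_div_int_add_rpow (1/2) (3/2)).2 (by norm_num))
    intro q
    have hq : (q : ℝ) + 1 / 2 ≠ 0 := by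
      intro h
      have : ((2 * q + 1 : ℤ) : ℝ) = 0 := by push_cast; linarith
      have : 2 * q + 1 = 0 := by exact_mod_cast this
      omega
    have hq' : 0 < |(q : ℝ) + 1 / 2| := abs_pos.2 hq
    apply one_div_le_one_div_of_le (by positivity)
    apply Real.rpow_le_rpow hq'.le _ (by norm_num)
    refine (abs_add_le _ _).trans ?_
    rw [abs_of_pos (by norm_num : (0:ℝ) < 1/2)]; linarith
  exact h1.mul_of_nonneg h2 (fun i => by positivity) (fun q => by positivity)

theorem szg_summable (z : ℝ) (hz : 0 < z) (hirr : Irrational z) (n N : ℤ) (hn : n ≠ 0)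
    (hN : (n : ℝ) * z ^ 2 = N) :
    Summable (fun m : ℕ => 1 / Real.cos (π * (m + 1) * z) / ((m : ℝ) + 1) ^ 2) := by
  obtain ⟨c, hc, hsep⟩ := szg_sep z hz hirr n N hn hN
  let x : ℕ → ℝ := fun m => 2 * Int.fract (((m:ℝ) + 1) * z) - 1
  let P : ℕ → ℝ := fun m => (2:ℝ) ^ (Nat.log 2 (m + 1))
  let q : ℕ → ℤ := fun m => ⌊x m * P m / (2 * c)⌋
  have hP0 : ∀ m, 0 < P m := fun m => by positivity
  have hP1 : ∀ m : ℕ, P m ≤ (m : ℝ) + 1 := by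
    intro m
    have := Nat.pow_log_le_self 2 (Nat.succ_ne_zero m)
    have h : ((2 ^ (Nat.log 2 (m + 1)) : ℕ) : ℝ) ≤ ((m + 1 : ℕ) : ℝ) := by exact_mod_cast this
    push_cast at h
    exact h
  have hP2 : ∀ m : ℕ, (m : ℝ) + 1 < 2 * P m := by
    intro m
    have := Nat.lt_pow_succ_log_self (by norm_num : 1 < 2) (m + 1)
    have h : (((m + 1 : ℕ)) : ℝ) < ((2 ^ (Nat.log 2 (m + 1)).succ : ℕ) : ℝ) := by exact_mod_cast this
    push_cast [pow_succ] at h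
    simp only [P]; linarith
  have hinj : Function.Injective (fun m => ((Nat.log 2 (m + 1), q m) : ℕ × ℤ)) := by
    intro m m' h
    simp only [Prod.mk.injEq] at h
    obtain ⟨h1, h2⟩ := h
    by_contra hne
    have hPP : P m = P m' := by simp only [P, h1]
    have h3 := Int.abs_sub_lt_one_of_floor_eq_floor h2
    have ha : ((m : ℤ) - m') ≠ 0 := by omega
    have h4 := hsep ((m : ℤ) - m') (⌊((m:ℝ) + 1) * z⌋ - ⌊((m':ℝ) + 1) * z⌋) ha
    have e : x m - x m' = 2 * ((((m : ℤ) - m' : ℤ) : ℝ) * z -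
        ((⌊((m:ℝ) + 1) * z⌋ - ⌊((m':ℝ) + 1) * z⌋ : ℤ) : ℝ)) := by
      simp only [x, Int.fract]; push_cast; ring
    have h5 : |(((m : ℤ) - m' : ℤ) : ℝ)| ≤ P m := by
      have a1 := hP1 m
      have a2 := hP2 m
      have a3 := hP1 m'
      have a4 := hP2 m'
      push_cast
      rw [abs_le]; constructor <;> linarith
    rw [← hPP, ← sub_div, ← sub_mul, e, abs_div, abs_mul, abs_mul, abs_two, abs_of_pos (hP0 m),
      abs_of_pos (by positivity : 0 < 2 * c), div_lt_one (by positivity)] at h3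
    have h6 := mul_le_mul_of_nonneg_right h5 (abs_nonneg ((((m : ℤ) - m' : ℤ) : ℝ) * z -
        ((⌊((m:ℝ) + 1) * z⌋ - ⌊((m':ℝ) + 1) * z⌋ : ℤ) : ℝ)))
    nlinarith
  have hsum := (szg_summable_aux.comp_injective hinj).mul_left ((17 / (2 * c)) ^ (3 / 2 : ℝ))
  refine Summable.of_norm_bounded hsum ?_
  intro m
  have hM : (0:ℝ) < (m : ℝ) + 1 := by positivity
  have hPm := hP0 m
  simp only [Function.comp]
  have hx1 : c ≤ 2 * ((m : ℝ) + 1) * |x m| := by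
    have h4 := hsep (2 * ((m : ℤ) + 1)) (2 * ⌊((m:ℝ) + 1) * z⌋ + 1) (by omega)
    push_cast at h4
    rw [abs_of_pos (by positivity : (0:ℝ) < 2 * ((m:ℝ) + 1))] at h4
    have : x m = 2 * ((m:ℝ) + 1) * z - (2 * (⌊((m:ℝ) + 1) * z⌋ : ℝ) + 1) := by
      simp only [x, Int.fract]; ring
    rw [this]; exact h4
  have hxpos : 0 < |x m| := by
    by_contra h
    have : |x m| = 0 := le_antisymm (not_lt.1 h) (abs_nonneg _)
    rw [this] at hx1; linarith
  have hq : 1 + |(q m : ℝ)| ≤ 17 * (|x m| * P m / (2 * c)) := by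
    have a1 : 1 / 8 ≤ |x m| * P m / (2 * c) := by
      rw [le_div_iff₀ (by positivity)]
      have := hP2 m
      nlinarith
    have a2 : |(q m : ℝ)| ≤ |x m| * P m / (2 * c) + 1 := by
      have b1 := Int.floor_le (x m * P m / (2 * c))
      have b2 := Int.lt_floor_add_one (x m * P m / (2 * c))
      have b3 : |x m| * P m / (2 * c) = |x m * P m / (2 * c)| := by
        rw [abs_div, abs_mul, abs_of_pos hPm, abs_of_pos (by positivity : 0 < 2 * c)]
      rw [b3]
      have b4 := neg_abs_le (x m * P m / (2 * c))
      have b5 := le_abs_self (x m * P m / (2 * c))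
      rw [abs_le]; constructor
      · simp only [q]; linarith
      · simp only [q]; linarith
    linarith
  have hcos := szg_cos_lower (((m:ℝ) + 1) * z)
  rw [← mul_assoc] at hcos
  set C := |Real.cos (π * ((m:ℝ) + 1) * z)| with hC
  have hC1 : C ≤ 1 := Real.abs_cos_le_one _
  have hCx : |x m| ≤ C := hcos
  have hCpos : 0 < C := lt_of_lt_of_le hxpos hCx
  have key : 1 / C ≤ (17 / (2 * c)) ^ (3 / 2 : ℝ) * (P m ^ (3 / 2 : ℝ) *
      (1 / (1 + |(q m : ℝ)|) ^ (3 / 2 : ℝ))) := by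
    have k1 : 1 / C ≤ (1 / C) ^ (3 / 2 : ℝ) := by
      have : 1 ≤ 1 / C := by rw [le_div_iff₀ hCpos]; linarith
      nth_rewrite 1 [← Real.rpow_one (1 / C)]
      exact Real.rpow_le_rpow_of_exponent_le this (by norm_num)
    have k2 : 1 / C ≤ 17 / (2 * c) * (P m * (1 / (1 + |(q m : ℝ)|))) := by
      have : 1 / C ≤ 1 / |x m| := one_div_le_one_div_of_le hxpos hCx
      refine this.trans ?_
      rw [div_le_iff₀ hxpos]
      have : 17 / (2 * c) * (P m * (1 / (1 + |(q m : ℝ)|))) * |x m| =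
        17 * (|x m| * P m / (2 * c)) / (1 + |(q m : ℝ)|) := by field_simp
      rw [this, le_div_iff₀ (by positivity)]
      linarith
    refine k1.trans ((Real.rpow_le_rpow (by positivity) k2 (by norm_num)).trans (le_of_eq ?_))
    rw [Real.mul_rpow (by positivity) (by positivity), Real.mul_rpow (by positivity) (by positivity),
      Real.div_rpow zero_le_one (by positivity), Real.one_rpow]
  have hPP : P m ^ (3 / 2 : ℝ) / P m ^ 2 = ((2:ℝ) ^ (-(1/2) : ℝ)) ^ (Nat.log 2 (m + 1)) := by
    rw [← Real.rpow_natCast (P m) 2, ← Real.rpow_sub hPm, ← Real.rpow_natCast, ← Real.rpow_mul (by norm_num)]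
    simp only [P]
    rw [← Real.rpow_natCast, ← Real.rpow_mul (by norm_num)]
    congr 1
    push_cast
    ring
  rw [norm_div, norm_div, norm_one, Real.norm_eq_abs, Real.norm_eq_abs, ← hC,
    abs_of_pos (by positivity : 0 < ((m:ℝ) + 1) ^ 2)]
  calc 1 / C / ((m:ℝ) + 1) ^ 2 ≤ 1 / C / P m ^ 2 := by
        gcongr
        exact hP1 m
    _ ≤ ((17 / (2 * c)) ^ (3 / 2 : ℝ) * (P m ^ (3 / 2 : ℝ) *
      (1 / (1 + |(q m : ℝ)|) ^ (3 / 2 : ℝ)))) / P m ^ 2 := by gcongr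
    _ = _ := by rw [← hPP]; ring

theorem szg_radius (α β : Fin 3 → ℝ) (hα : ∀ i, 0 < α i) :
    ∃ δ : ℝ, 0 < δ ∧ ∀ K : ℝ, ∃ R : ℝ, K ≤ R ∧ ∀ i, ∀ k : ℤ, δ ≤ |R * α i - β i - k| := by
  obtain ⟨t, ht, htα⟩ : ∃ t : ℝ, 0 < t ∧ ∀ i, α i * t ≤ 1 / 6 := by
    have h0 := hα 0
    have h1 := hα 1
    have h2 := hα 2
    refine ⟨1 / (6 * (α 0 + α 1 + α 2)), by positivity, ?_⟩
    intro i
    rw [mul_one_div, div_le_div_iff₀ (by positivity) (by norm_num)]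
    fin_cases i <;> simp <;> linarith
  obtain ⟨a, ha, haα⟩ : ∃ a : ℝ, 0 < a ∧ ∀ i, a ≤ α i := by
    refine ⟨min (α 0) (min (α 1) (α 2)), by simp [hα], ?_⟩
    intro i
    fin_cases i <;> simp
  refine ⟨a * t / 2, by positivity, ?_⟩
  intro K
  by_contra! H
  have H' : ∀ s : Fin 4, ∃ i, ∃ k : ℤ, |(K + (s : ℕ) * t) * α i - β i - k| < a * t / 2 :=
    fun s => H _ (by have : (0:ℝ) ≤ ((s:ℕ) : ℝ) * t := by positivity
                     linarith)
  choose f k hfk using H'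
  obtain ⟨s, s', hne, hss⟩ := Fintype.exists_ne_map_eq_of_card_lt f (by simp)
  wlog hlt : s < s' generalizing s s'
  · exact this s' s hne.symm hss.symm (lt_of_le_of_ne (not_lt.1 hlt) hne.symm)
  have h1 := hfk s
  have h2 := hfk s'
  rw [← hss] at h2
  have hb := htα (f s)
  have hc := haα (f s)
  set A := α (f s)
  have hA : 0 < A := hα _
  have hd1 : (1:ℝ) ≤ ((s' : ℕ) : ℝ) - ((s : ℕ) : ℝ) := by
    have : (s : ℕ) + 1 ≤ (s' : ℕ) := hlt
    have : (((s : ℕ) + 1 : ℕ) : ℝ) ≤ ((s' : ℕ) : ℝ) := by exact_mod_cast this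
    push_cast at this; linarith
  have hd2 : ((s' : ℕ) : ℝ) - ((s : ℕ) : ℝ) ≤ 3 := by
    have h3 : (s' : ℕ) ≤ 3 := by omega
    have : ((s' : ℕ) : ℝ) ≤ 3 := by exact_mod_cast h3
    have : (0:ℝ) ≤ ((s : ℕ) : ℝ) := by positivity
    linarith
  rw [abs_lt] at h1 h2
  have hAt : a * t ≤ A * t := by gcongr
  have hAt0 : 0 < A * t := by positivity
  have m1 := mul_le_mul_of_nonneg_right hd1 hAt0.le
  have m2 := mul_le_mul_of_nonneg_right hd2 hAt0.le
  have hk : k s' = k s := by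
    have u1 : ((k s' - k s : ℤ) : ℝ) < 1 := by push_cast; nlinarith
    have u2 : (-1 : ℝ) < ((k s' - k s : ℤ) : ℝ) := by push_cast; nlinarith
    have u1' : k s' - k s < 1 := by exact_mod_cast u1
    have u2' : -1 < k s' - k s := by exact_mod_cast u2
    omega
  rw [hk] at h2
  nlinarith

open Filter Topology in
theorem szg_inv_lim (φ : ℂ → ℂ) (d p : ℂ) (hφ : HasDerivAt φ d p) (h0 : φ p = 0) (hd : d ≠ 0) :
    Tendsto (fun w => (w - p) * (φ w)⁻¹) (𝓝[≠] p) (𝓝 d⁻¹) := by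
  refine (hφ.tendsto_slope.inv₀ hd).congr ?_
  intro w
  rw [slope_def_field, h0, sub_zero, inv_div, div_eq_mul_inv]

open Filter Topology in
theorem szg_cot_res (μ p : ℂ) (hμ : μ ≠ 0) (h0 : Complex.sin (π * (μ * p)) = 0) :
    Tendsto (fun w => (w - p) * Complex.cot (π * (μ * w))) (𝓝[≠] p) (𝓝 (1 / (π * μ))) := by
  have hpi : (π : ℂ) ≠ 0 := by exact_mod_cast Real.pi_ne_zero
  have hc : Complex.cos (π * (μ * p)) ≠ 0 := by
    intro h
    have := Complex.sin_sq_add_cos_sq (π * (μ * p))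
    rw [h, h0] at this
    norm_num at this
  have hd : HasDerivAt (fun w : ℂ => Complex.sin (π * (μ * w)))
      (Complex.cos (π * (μ * p)) * (π * μ)) p := by
    have h1 : HasDerivAt (fun w : ℂ => (π:ℂ) * (μ * w)) (π * μ) p := by
      simpa using ((hasDerivAt_id p).const_mul μ).const_mul (π:ℂ)
    exact h1.csin
  have h1 := szg_inv_lim _ _ _ hd h0 (by positivity)
  have h2 : Tendsto (fun w : ℂ => Complex.cos (π * (μ * w))) (𝓝[≠] p)
      (𝓝 (Complex.cos (π * (μ * p)))) := by
    have : Continuous (fun w : ℂ => Complex.cos (π * (μ * w))) := by fun_prop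
    exact (this.tendsto p).mono_left nhdsWithin_le_nhds
  have h3 := h1.mul h2
  have e : (Complex.cos (π * (μ * p)) * (π * μ))⁻¹ * Complex.cos (π * (μ * p)) = 1 / (π * μ) := by
    rw [mul_inv, mul_right_comm, inv_mul_cancel₀ hc, one_mul, one_div]
  rw [e] at h3
  refine h3.congr ?_
  intro w
  simp only [Complex.cot]
  ring

open Filter Topology in
theorem szg_sec_res (z p : ℂ) (hz : z ≠ 0) (h0 : Complex.cos (π * (z * p)) = 0) :
    ∃ L, Tendsto (fun w => (w - p) * (Complex.cos (π * (z * w)))⁻¹) (𝓝[≠] p) (𝓝 L) := by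
  have hpi : (π : ℂ) ≠ 0 := by exact_mod_cast Real.pi_ne_zero
  have hc : Complex.sin (π * (z * p)) ≠ 0 := by
    intro h
    have := Complex.sin_sq_add_cos_sq (π * (z * p))
    rw [h, h0] at this
    norm_num at this
  have hd : HasDerivAt (fun w : ℂ => Complex.cos (π * (z * w)))
      (-Complex.sin (π * (z * p)) * (π * z)) p := by
    have h1 : HasDerivAt (fun w : ℂ => (π:ℂ) * (z * w)) (π * z) p := by
      simpa using ((hasDerivAt_id p).const_mul z).const_mul (π:ℂ)
    exact h1.ccos
  exact ⟨_, szg_inv_lim _ _ _ hd h0 (by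
    simp only [ne_eq, mul_eq_zero, neg_eq_zero, not_or]; exact ⟨hc, hpi, hz⟩)⟩

noncomputable def szgF (μ z w : ℂ) : ℂ :=
  (Complex.cot (π * w) - Complex.cot (π * (μ * w))) / w ^ 2 * (Complex.cos (π * (z * w)))⁻¹

noncomputable def szgG (μ z w : ℂ) : ℂ :=
  szgF μ z w - (1 - 1 / μ) / π * (w - 0) ^ (-3 : ℤ) -
    (π * z ^ 2 / 2 * (1 - 1 / μ) - π / 3 * (1 - μ)) * (w - 0)⁻¹

open Filter Topology in
theorem szg_lim_zero (μ z : ℂ) (hμ : μ ≠ 0) (hz : z ≠ 0) :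
    Tendsto (fun w => (w - 0) * szgG μ z w) (𝓝[≠] 0) (𝓝 0) := by
  have hpi : (π : ℂ) ≠ 0 := by exact_mod_cast Real.pi_ne_zero
  have l1 := szg_cot_lim.comp (szg_scale π hpi)
  have l2 := szg_cot_lim.comp (szg_scale (π * μ) (mul_ne_zero hpi hμ))
  have l3 := szg_cos_lim.comp (szg_scale (π * z) (mul_ne_zero hpi hz))
  have l4 : Tendsto (fun w : ℂ => (Complex.cos (π * (z * w)))⁻¹) (𝓝[≠] 0) (𝓝 1) := by
    have : ContinuousAt (fun w : ℂ => (Complex.cos (π * (z * w)))⁻¹) 0 := by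
      have : Complex.cos (π * (z * 0)) ≠ 0 := by simp
      fun_prop (disch := assumption)
    have := this.tendsto
    simp only [mul_zero, Complex.cos_zero, inv_one] at this
    exact this.mono_left nhdsWithin_le_nhds
  have l5 := ((l4.mul ((l1.const_mul (π:ℂ)).sub (l2.const_mul (π * μ)))).add
    ((l3.mul l4).const_mul ((1 - 1 / μ) / π * (π * z) ^ 2))).sub
    (tendsto_const_nhds (x := (π * z ^ 2 / 2 * (1 - 1 / μ) - π / 3 * (1 - μ))))
  have e0 : 1 * ((π:ℂ) * (-1 / 3) - π * μ * (-1 / 3)) + (1 - 1 / μ) / π * (π * z) ^ 2 * (1 / 2 * 1) -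
      (π * z ^ 2 / 2 * (1 - 1 / μ) - π / 3 * (1 - μ)) = 0 := by
    field_simp; ring
  rw [e0] at l5
  refine l5.congr' ?_
  have hne := l4.eventually_ne one_ne_zero
  filter_upwards [self_mem_nhdsWithin, hne] with w hw hc
  have hw : w ≠ 0 := hw
  have hc : Complex.cos (π * (z * w)) ≠ 0 := by
    intro h; simp [h] at hc
  simp only [Function.comp, szgG, szgF, sub_zero, zpow_neg]
  rw [show (π:ℂ) * z * w = π * (z * w) by ring, show (π:ℂ) * μ * w = π * (μ * w) by ring]
  generalize Complex.cot (π * w) = A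
  generalize Complex.cot (π * (μ * w)) = B
  generalize Complex.cos (π * (z * w)) = C at *
  have : w ^ (3:ℤ) = w ^ 3 := by norm_cast
  rw [this]
  field_simp
  ring

open Filter Topology in
theorem szg_G_of_F (μ z p c : ℂ) (hp : p ≠ 0)
    (h : Tendsto (fun w => (w - p) * szgF μ z w) (𝓝[≠] p) (𝓝 c)) :
    Tendsto (fun w => (w - p) * szgG μ z w) (𝓝[≠] p) (𝓝 c) := by
  have : ContinuousAt (fun w : ℂ => (w - p) * ((1 - 1 / μ) / π * (w - 0) ^ (-3 : ℤ) +
    (π * z ^ 2 / 2 * (1 - 1 / μ) - π / 3 * (1 - μ)) * (w - 0)⁻¹)) p := by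
    have h1 : p - 0 ≠ 0 := by simpa using hp
    have h2 : ContinuousAt (fun w : ℂ => (w - 0) ^ (-3 : ℤ)) p :=
      ContinuousAt.zpow₀ (by fun_prop) _ (Or.inl h1)
    have h3 : ContinuousAt (fun w : ℂ => (w - 0)⁻¹) p := by fun_prop (disch := assumption)
    fun_prop
  have h1 := this.tendsto
  simp only [sub_self, zero_mul] at h1
  have h2 := h.sub (h1.mono_left nhdsWithin_le_nhds)
  rw [sub_zero] at h2
  refine h2.congr ?_
  intro w
  simp only [szgG]
  ring

theorem szg_sin_zero {w : ℂ} (h : Complex.sin (π * w) = 0) : ∃ k : ℤ, w = k := by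
  have hpi : (π : ℂ) ≠ 0 := by exact_mod_cast Real.pi_ne_zero
  obtain ⟨k, hk⟩ := Complex.sin_eq_zero_iff.1 h
  exact ⟨k, mul_left_cancel₀ hpi (by rw [hk]; ring)⟩

theorem szg_cos_zero {w : ℂ} (h : Complex.cos (π * w) = 0) : ∃ k : ℤ, w = k + 1 / 2 := by
  have hpi : (π : ℂ) ≠ 0 := by exact_mod_cast Real.pi_ne_zero
  obtain ⟨k, hk⟩ := Complex.cos_eq_zero_iff.1 h
  exact ⟨k, mul_left_cancel₀ hpi (by rw [hk]; ring)⟩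

theorem szg_sin_int (k : ℤ) : Complex.sin (π * k) = 0 := by
  rw [mul_comm, Complex.sin_int_mul_pi]

theorem szg_cos_half (k : ℤ) : Complex.cos (π * (k + 1 / 2)) = 0 :=
  Complex.cos_eq_zero_iff.2 ⟨k, by ring⟩

/-- pairwise independence of the three pole families -/
theorem szg_indep {z μ : ℂ} {n : ℤ} (hn : n ≠ 0) (Hz : ∀ a b : ℤ, (a : ℂ) * z = b → a = 0)
    (hμ : μ = 2 * n * z + 1) :
    (∀ k l : ℤ, μ * k = l → k = 0) ∧ (∀ k l : ℤ, z * k ≠ l + 1 / 2) ∧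
    (∀ (w : ℂ) (k l : ℤ), μ * w = k → z * w ≠ l + 1 / 2) := by
  have h1 : ∀ k l : ℤ, z * k ≠ l + 1 / 2 := by
    intro k l h
    have h2 := Hz (2 * k) (2 * l + 1) (by push_cast; linear_combination 2 * h)
    have h3 : k = 0 := by omega
    rw [h3] at h
    have h4 : ((2 * l + 1 : ℤ) : ℂ) = 0 := by push_cast; push_cast at h; linear_combination -2 * h
    have : 2 * l + 1 = 0 := by exact_mod_cast h4
    omega
  refine ⟨?_, h1, ?_⟩
  · intro k l h
    have := Hz (2 * n * k) (l - k) (by push_cast; rw [hμ] at h; linear_combination h)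
    simpa [hn] using this
  · intro w k l h h2
    have hw : w = ((k - n * (2 * l + 1) : ℤ) : ℂ) := by
      push_cast; rw [hμ] at h; linear_combination h - 2 * n * h2
    exact h1 (k - n * (2 * l + 1)) l (by rw [← hw]; exact h2)

theorem szg_F_diff (μ z w : ℂ) (h0 : w ≠ 0) (h1 : Complex.sin (π * w) ≠ 0)
    (h2 : Complex.sin (π * (μ * w)) ≠ 0) (h3 : Complex.cos (π * (z * w)) ≠ 0) :
    DifferentiableAt ℂ (szgF μ z) w := by
  unfold szgF
  simp only [Complex.cot]
  have : w ^ 2 ≠ 0 := pow_ne_zero 2 h0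
  fun_prop (disch := assumption)

theorem szg_G_diff (μ z w : ℂ) (h0 : w ≠ 0) (h1 : Complex.sin (π * w) ≠ 0)
    (h2 : Complex.sin (π * (μ * w)) ≠ 0) (h3 : Complex.cos (π * (z * w)) ≠ 0) :
    DifferentiableAt ℂ (szgG μ z) w := by
  have := szg_F_diff μ z w h0 h1 h2 h3
  unfold szgG
  have h4 : w - 0 ≠ 0 := by simpa using h0
  have h5 : DifferentiableAt ℂ (fun w : ℂ => (w - 0) ^ (-3 : ℤ)) w :=
    DifferentiableAt.zpow (by fun_prop) (Or.inl h4)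
  have h6 : DifferentiableAt ℂ (fun w : ℂ => (w - 0)⁻¹) w := by fun_prop (disch := assumption)
  fun_prop

open Filter Topology in
theorem szg_F_res1 (μ z : ℂ) (k : ℤ) (hk : k ≠ 0)
    (h2 : Complex.sin (π * (μ * k)) ≠ 0) (h3 : Complex.cos (π * (z * k)) ≠ 0) :
    Tendsto (fun w => (w - k) * szgF μ z w) (𝓝[≠] (k : ℂ))
      (𝓝 (1 / π * ((Complex.cos (π * (z * k)))⁻¹ / (k : ℂ) ^ 2))) := by
  have hpi : (π : ℂ) ≠ 0 := by exact_mod_cast Real.pi_ne_zero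
  have hk' : (k : ℂ) ≠ 0 := by exact_mod_cast hk
  have hk2 : (k : ℂ) ^ 2 ≠ 0 := pow_ne_zero 2 hk'
  have l1 := szg_cot_res 1 k one_ne_zero (by rw [one_mul]; exact szg_sin_int k)
  have c1 : ContinuousAt (fun w : ℂ => (w ^ 2)⁻¹ * (Complex.cos (π * (z * w)))⁻¹) k := by
    fun_prop (disch := assumption)
  have c2 : ContinuousAt (fun w : ℂ => (w - k) * (Complex.cot (π * (μ * w)) * ((w ^ 2)⁻¹ *
      (Complex.cos (π * (z * w)))⁻¹))) k := by
    simp only [Complex.cot]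
    fun_prop (disch := assumption)
  have l2 := (l1.mul (c1.tendsto.mono_left nhdsWithin_le_nhds)).sub
    (c2.tendsto.mono_left nhdsWithin_le_nhds)
  have e : 1 / ((π:ℂ) * 1) * (((k:ℂ) ^ 2)⁻¹ * (Complex.cos (π * (z * k)))⁻¹) -
      ((k:ℂ) - k) * (Complex.cot (π * (μ * k)) * (((k:ℂ) ^ 2)⁻¹ * (Complex.cos (π * (z * k)))⁻¹)) =
      1 / π * ((Complex.cos (π * (z * k)))⁻¹ / (k : ℂ) ^ 2) := by ring
  rw [e] at l2
  refine l2.congr ?_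
  intro w
  simp only [szgF, one_mul]
  ring

open Filter Topology in
theorem szg_F_res2 (μ z p : ℂ) (hμ : μ ≠ 0) (hp : p ≠ 0)
    (h1 : Complex.sin (π * p) ≠ 0)
    (h2 : Complex.sin (π * (μ * p)) = 0) (h3 : Complex.cos (π * (z * p)) ≠ 0) :
    Tendsto (fun w => (w - p) * szgF μ z w) (𝓝[≠] p)
      (𝓝 (-(1 / (π * μ)) * ((Complex.cos (π * (z * p)))⁻¹ / p ^ 2))) := by
  have hk2 : p ^ 2 ≠ 0 := pow_ne_zero 2 hp
  have l1 := szg_cot_res μ p hμ h2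
  have c1 : ContinuousAt (fun w : ℂ => (w ^ 2)⁻¹ * (Complex.cos (π * (z * w)))⁻¹) p := by
    fun_prop (disch := assumption)
  have c2 : ContinuousAt (fun w : ℂ => (w - p) * (Complex.cot (π * w) * ((w ^ 2)⁻¹ *
      (Complex.cos (π * (z * w)))⁻¹))) p := by
    simp only [Complex.cot]
    fun_prop (disch := assumption)
  have l2 := (c2.tendsto.mono_left nhdsWithin_le_nhds).sub
    (l1.mul (c1.tendsto.mono_left nhdsWithin_le_nhds))
  have e : (p - p) * (Complex.cot (π * p) * ((p ^ 2)⁻¹ * (Complex.cos (π * (z * p)))⁻¹)) -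
    1 / ((π:ℂ) * μ) * ((p ^ 2)⁻¹ * (Complex.cos (π * (z * p)))⁻¹) =
      -(1 / (π * μ)) * ((Complex.cos (π * (z * p)))⁻¹ / p ^ 2) := by ring
  rw [e] at l2
  refine l2.congr ?_
  intro w
  simp only [szgF]
  ring

open Filter Topology in
theorem szg_F_res3 (μ z p : ℂ) (hz : z ≠ 0) (hp : p ≠ 0) (K : ℤ) (hK : μ * p = p + K)
    (h1 : Complex.sin (π * p) ≠ 0)
    (h2 : Complex.sin (π * (μ * p)) ≠ 0) (h3 : Complex.cos (π * (z * p)) = 0) :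
    Tendsto (fun w => (w - p) * szgF μ z w) (𝓝[≠] p) (𝓝 0) := by
  have hk2 : p ^ 2 ≠ 0 := pow_ne_zero 2 hp
  obtain ⟨L, l1⟩ := szg_sec_res z p hz h3
  have c1 : ContinuousAt (fun w : ℂ => (Complex.cot (π * w) - Complex.cot (π * (μ * w))) / w ^ 2) p := by
    simp only [Complex.cot]
    fun_prop (disch := assumption)
  have l2 := (c1.tendsto.mono_left nhdsWithin_le_nhds).mul l1
  have e : Complex.cot (π * p) - Complex.cot (π * (μ * p)) = 0 := by
    simp only [Complex.cot]
    rw [div_sub_div _ _ h1 h2]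
    have : Complex.cos (π * p) * Complex.sin (π * (μ * p)) -
        Complex.sin (π * p) * Complex.cos (π * (μ * p)) = 0 := by
      have h4 := szg_sin_int K
      have h5 : (π:ℂ) * K = π * (μ * p) - π * p := by rw [hK]; ring
      rw [h5, Complex.sin_sub] at h4
      linear_combination h4
    rw [this, zero_div]
  rw [e, zero_div, zero_mul] at l2
  refine l2.congr ?_
  intro w
  simp only [szgF]
  ring

noncomputable def szgT (r : ℝ) : Finset ℤ := Finset.Ioo (-⌈r⌉) ⌈r⌉

theorem szg_mem_T (r : ℝ) (k : ℤ) : k ∈ szgT r ↔ |(k : ℝ)| < r := by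
  unfold szgT
  rw [Finset.mem_Ioo, abs_lt, Int.lt_ceil, neg_lt, Int.lt_ceil]
  push_cast
  rw [neg_lt]

open Filter Topology in
theorem szg_T_tendsto : Tendsto szgT atTop atTop := by
  have h : Tendsto (fun r : ℝ => ⌈r⌉) atTop atTop := tendsto_ceil_atTop
  exact Finset.tendsto_Ioo_neg_atTop_atTop.comp h

noncomputable def szgA (u : ℝ) (k : ℤ) : ℝ := (Real.cos (π * (u * k)))⁻¹ / (k : ℝ) ^ 2

noncomputable def szgT3 (r : ℝ) : Finset ℤ := (szgT (r + 1)).filter (fun k => |(k : ℝ) + 1 / 2| < r)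

theorem szg_mem_T3 (r : ℝ) (k : ℤ) : k ∈ szgT3 r ↔ |(k : ℝ) + 1 / 2| < r := by
  unfold szgT3
  rw [Finset.mem_filter, szg_mem_T]
  refine ⟨fun h => h.2, fun h => ⟨?_, h⟩⟩
  rw [abs_lt] at *
  constructor <;> linarith [h.1, h.2]

theorem szg_cos_shift (u : ℝ) (j k : ℤ) :
    Complex.cos (π * (((u : ℂ) + 2 * j) * k)) = ((Real.cos (π * (u * k)) : ℝ) : ℂ) := by
  have : (π:ℂ) * (((u : ℂ) + 2 * j) * k) = π * (u * k) + ((j * k : ℤ) : ℂ) * (2 * π) := by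
    push_cast; ring
  rw [this, Complex.cos_add_int_mul_two_pi]
  push_cast
  rfl

open Filter Topology in
theorem szg_contour (u : ℝ) (hu : Irrational u) (j n : ℤ) (hn : n ≠ 0) (z μ : ℝ)
    (hz : z = u + 2 * j) (hμ : μ = 2 * n * z + 1) (hzμ : z = μ * (u - 2 * j))
    (R : ℝ) (hR : 0 < R) (hR1 : ∀ k : ℤ, R * 1 - 0 - k ≠ 0)
    (hR2 : ∀ k : ℤ, R * |μ| - 0 - k ≠ 0) (hR3 : ∀ k : ℤ, R * |z| - 1 / 2 - k ≠ 0) :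
    (∮ w in C(0, R), szgF μ z w) = 2 * π * Complex.I *
      ((π * z ^ 2 / 2 * (1 - 1 / μ) - π / 3 * (1 - μ)) + 1 / π * ∑ k ∈ szgT R, (szgA u k : ℂ)
        - μ / π * ∑ k ∈ szgT (|μ| * R), (szgA u k : ℂ)) := by
  have hpi : (π : ℂ) ≠ 0 := by exact_mod_cast Real.pi_ne_zero
  have hzirr : Irrational z := by
    rw [hz]
    have := hu.add_intCast (2 * j)
    push_cast at this; exact this
  have Hz : ∀ a b : ℤ, (a : ℂ) * z = b → a = 0 := by
    intro a b h
    by_contra ha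
    have h' : (a : ℝ) * z = b := by exact_mod_cast h
    exact (hzirr.intCast_mul ha).ne_int b h'
  have hz0 : z ≠ 0 := hzirr.ne_zero
  have hz0' : (z : ℂ) ≠ 0 := by exact_mod_cast hz0
  have hμ0 : μ ≠ 0 := by
    rintro rfl
    rw [zero_mul] at hzμ
    exact hz0 hzμ
  have hμ0' : (μ : ℂ) ≠ 0 := by exact_mod_cast hμ0
  have hμ' : (μ : ℂ) = 2 * n * z + 1 := by rw [hμ]; push_cast; rfl
  have hz' : (z : ℂ) = u + 2 * j := by rw [hz]; push_cast; rfl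
  have hzμ' : (z : ℂ) = μ * (u - 2 * j) := by
    have : ((z : ℝ) : ℂ) = ((μ * (u - 2 * j) : ℝ) : ℂ) := by rw [← hzμ]
    rw [this]; push_cast; rfl
  obtain ⟨I1, I2, I3⟩ := szg_indep hn Hz hμ'
  -- the index data
  let p : ℤ ⊕ (ℤ ⊕ ℤ) → ℂ := Sum.elim (fun k => (k : ℂ))
    (Sum.elim (fun k => (k : ℂ) / μ) (fun k => ((k : ℂ) + 1 / 2) / z))
  let c : ℤ ⊕ (ℤ ⊕ ℤ) → ℂ := Sum.elim (fun k => 1 / π * (szgA u k : ℂ))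
    (Sum.elim (fun k => -(μ / π) * (szgA u k : ℂ)) (fun _ => 0))
  let S : Finset (ℤ ⊕ (ℤ ⊕ ℤ)) := (szgT R).disjSum
    (((szgT (|μ| * R)).erase 0).disjSum (szgT3 (|z| * R)))
  have hS1 : ∀ k, Sum.inl k ∈ S ↔ |(k : ℝ)| < R := by
    intro k; simp [S, szg_mem_T]
  have hS2 : ∀ k, Sum.inr (Sum.inl k) ∈ S ↔ k ≠ 0 ∧ |(k : ℝ)| < |μ| * R := by
    intro k; simp [S, szg_mem_T]
  have hS3 : ∀ k, Sum.inr (Sum.inr k) ∈ S ↔ |(k : ℝ) + 1 / 2| < |z| * R := by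
    intro k
    rw [← szg_mem_T3]; simp [S]
  have q2 : ∀ k : ℤ, (μ : ℂ) * ((k : ℂ) / μ) = k := fun k => by field_simp
  have q3 : ∀ k : ℤ, (z : ℂ) * (((k : ℂ) + 1 / 2) / z) = k + 1 / 2 := fun k => by field_simp
  have n2 : ∀ k : ℤ, ‖(k : ℂ) / μ‖ = |(k : ℝ)| / |μ| := fun k => by
    rw [norm_div, Complex.norm_intCast, Complex.norm_real, Real.norm_eq_abs]
  have n3 : ∀ k : ℤ, ‖((k : ℂ) + 1 / 2) / z‖ = |(k : ℝ) + 1 / 2| / |z| := fun k => by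
    rw [norm_div, Complex.norm_real, Real.norm_eq_abs]
    congr 1
    rw [← Real.norm_eq_abs, ← Complex.norm_real]
    push_cast; rfl
  have hres := szg_residue R hR p c S (szgG μ z) ?_ ?_ ?_ ?_
  · -- conclusion
    have hns : ∀ w ∈ Metric.sphere (0:ℂ) R, w - 0 ≠ 0 := by
      rintro w hw h
      rw [sub_zero] at h
      simp [h] at hw
      linarith
    have i1 : CircleIntegrable (fun w : ℂ => (1 - 1 / (μ:ℂ)) / π * (w - 0) ^ (-3 : ℤ)) 0 R := by
      refine ContinuousOn.circleIntegrable hR.le ?_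
      refine continuousOn_const.mul (ContinuousOn.zpow₀ (by fun_prop) _ ?_)
      intro w hw; exact Or.inl (hns w hw)
    have i2 : CircleIntegrable (fun w : ℂ => ((π:ℂ) * z ^ 2 / 2 * (1 - 1 / μ) - π / 3 * (1 - μ)) *
        (w - 0)⁻¹) 0 R := by
      refine ContinuousOn.circleIntegrable hR.le ?_
      exact continuousOn_const.mul (ContinuousOn.inv₀ (by fun_prop) hns)
    have i0 : CircleIntegrable (szgF μ z) 0 R := by
      refine ContinuousOn.circleIntegrable hR.le ?_
      intro w hw
      have hwR : ‖w‖ = R := by simpa using hw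
      refine (szg_F_diff _ _ _ ?_ ?_ ?_ ?_).continuousAt.continuousWithinAt
      · simpa using hns w hw
      · intro h
        obtain ⟨k, rfl⟩ := szg_sin_zero h
        rw [Complex.norm_intCast] at hwR
        refine hR1 |k| ?_
        push_cast; linarith
      · intro h
        obtain ⟨k, hk⟩ := szg_sin_zero h
        have : |μ| * R = |(k:ℝ)| := by
          rw [← hwR, ← Real.norm_eq_abs, ← Complex.norm_real, ← norm_mul, hk, Complex.norm_intCast]
        refine hR2 |k| ?_
        push_cast; linarith
      · intro h
        obtain ⟨k, hk⟩ := szg_cos_zero h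
        have : |z| * R = |(k:ℝ) + 1 / 2| := by
          rw [← hwR, ← Real.norm_eq_abs, ← Complex.norm_real, ← norm_mul, hk, ← Real.norm_eq_abs,
            ← Complex.norm_real]
          push_cast; rfl
        rcases abs_choice ((k:ℝ) + 1 / 2) with h5 | h5
        · exact hR3 k (by rw [h5] at this; linarith)
        · exact hR3 (-k - 1) (by rw [h5] at this; push_cast; linarith)
    have hG : (∮ w in C(0, R), szgG μ z w) = (∮ w in C(0, R), szgF μ z w) -
        2 * π * Complex.I * (π * z ^ 2 / 2 * (1 - 1 / μ) - π / 3 * (1 - μ)) := by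
      unfold szgG
      have i01 : CircleIntegrable (fun w : ℂ => szgF μ z w -
          (1 - 1 / (μ:ℂ)) / π * (w - 0) ^ (-3 : ℤ)) 0 R := i0.sub i1
      rw [circleIntegral.integral_sub i01 i2, circleIntegral.integral_sub i0 i1,
        circleIntegral.integral_const_mul, circleIntegral.integral_const_mul,
        circleIntegral.integral_sub_zpow_of_ne (by norm_num),
        circleIntegral.integral_sub_center_inv _ hR.ne']
      ring
    have hsum : ∑ i ∈ S, c i = 1 / π * ∑ k ∈ szgT R, (szgA u k : ℂ)
        - μ / π * ∑ k ∈ szgT (|μ| * R), (szgA u k : ℂ) := by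
      simp only [S, Finset.sum_disjSum, c, Sum.elim_inl, Sum.elim_inr, Finset.sum_const_zero,
        add_zero]
      have he : ∑ k ∈ (szgT (|μ| * R)).erase 0, -((μ:ℂ) / π) * (szgA u k : ℂ) =
          ∑ k ∈ szgT (|μ| * R), -((μ:ℂ) / π) * (szgA u k : ℂ) := by
        apply Finset.sum_erase
        simp [szgA]
      rw [he, ← Finset.mul_sum, ← Finset.mul_sum]
      ring
    rw [hG, hsum] at hres
    linear_combination hres
  · -- injectivity
    have a12 : ∀ k l : ℤ, Sum.inr (Sum.inl l) ∈ S → (k : ℂ) ≠ (l : ℂ) / μ := by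
      intro k l hl h
      have h1 : (μ : ℂ) * k = l := by rw [h, q2]
      have hk := I1 k l h1
      rw [hk] at h1
      have : (l : ℂ) = 0 := by rw [← h1]; simp
      exact ((hS2 l).1 hl).1 (by exact_mod_cast this)
    have a13 : ∀ k l : ℤ, (k : ℂ) ≠ ((l : ℂ) + 1 / 2) / z := by
      intro k l h
      exact I2 k l (by rw [h, q3])
    have a23 : ∀ k l : ℤ, (k : ℂ) / μ ≠ ((l : ℂ) + 1 / 2) / z := by
      intro k l h
      exact I3 _ k l (q2 k) (by rw [h, q3])
    rintro (k | k | k) hk (l | l | l) hl h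
    · have : (k : ℂ) = l := h
      rw [Int.cast_injective this]
    · exact absurd h (a12 k l hl)
    · exact absurd h (a13 k l)
    · exact absurd h.symm (a12 l k hk)
    · have : (k : ℂ) / μ = l / μ := h
      have : (k : ℂ) = l := by rw [← q2 k, this, q2]
      rw [Int.cast_injective this]
    · exact absurd h (a23 k l)
    · exact absurd h.symm (a13 l k)
    · exact absurd h.symm (a23 l k)
    · have : ((k : ℂ) + 1 / 2) / z = (l + 1 / 2) / z := h
      have : (k : ℂ) + 1 / 2 = l + 1 / 2 := by rw [← q3 k, this, q3]
      rw [Int.cast_injective (add_right_cancel this)]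
  · -- inside
    rintro (k | k | k) hk
    · simpa [p] using (hS1 k).1 hk
    · change ‖(k : ℂ) / μ‖ < R
      rw [n2, div_lt_iff₀ (abs_pos.2 hμ0), mul_comm]
      exact ((hS2 k).1 hk).2
    · change ‖((k : ℂ) + 1 / 2) / z‖ < R
      rw [n3, div_lt_iff₀ (abs_pos.2 hz0), mul_comm]
      exact (hS3 k).1 hk
  · -- differentiability
    intro w hw hS
    have hw0 : w ≠ 0 := by
      have := hS (Sum.inl 0) ((hS1 0).2 (by simpa using hR))
      simpa [p] using this
    refine szg_G_diff _ _ _ hw0 ?_ ?_ ?_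
    · intro h
      obtain ⟨k, rfl⟩ := szg_sin_zero h
      rw [Complex.norm_intCast] at hw
      refine hS (Sum.inl k) ((hS1 k).2 (lt_of_le_of_ne hw ?_)) rfl
      intro h5
      refine hR1 |k| ?_
      push_cast; linarith
    · intro h
      obtain ⟨k, hk⟩ := szg_sin_zero h
      have hwk : w = (k : ℂ) / μ := by rw [← hk]; field_simp
      have hk0 : k ≠ 0 := by
        rintro rfl
        simp at hwk; exact hw0 hwk
      have h6 : |(k:ℝ)| ≤ |μ| * R := by
        rw [hwk, n2, div_le_iff₀ (abs_pos.2 hμ0)] at hw; linarith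
      refine hS (Sum.inr (Sum.inl k)) ((hS2 k).2 ⟨hk0, lt_of_le_of_ne h6 ?_⟩) hwk
      intro h5
      refine hR2 |k| ?_
      push_cast; linarith
    · intro h
      obtain ⟨k, hk⟩ := szg_cos_zero h
      have hwk : w = ((k : ℂ) + 1 / 2) / z := by rw [← hk]; field_simp
      have h6 : |(k:ℝ) + 1 / 2| ≤ |z| * R := by
        rw [hwk, n3, div_le_iff₀ (abs_pos.2 hz0)] at hw; linarith
      refine hS (Sum.inr (Sum.inr k)) ((hS3 k).2 (lt_of_le_of_ne h6 ?_)) hwk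
      intro this
      rcases abs_choice ((k:ℝ) + 1 / 2) with h5 | h5
      · exact hR3 k (by rw [h5] at this; linarith)
      · exact hR3 (-k - 1) (by rw [h5] at this; push_cast; linarith)
  · -- residues
    rintro (k | k | k) hk
    · change Tendsto (fun w => (w - (k:ℂ)) * szgG μ z w) (𝓝[≠] (k:ℂ)) (𝓝 (1 / π * (szgA u k : ℂ)))
      by_cases hk0 : k = 0
      · subst hk0
        have := szg_lim_zero μ z hμ0' hz0'
        simpa [szgA] using this
      · have hk0' : (k : ℂ) ≠ 0 := by exact_mod_cast hk0
        have := szg_G_of_F _ _ _ _ hk0' (szg_F_res1 μ z k hk0 ?_ ?_)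
        · have e : Complex.cos (π * (z * k)) = ((Real.cos (π * (u * k)) : ℝ) : ℂ) := by
            rw [hz', szg_cos_shift]
          rw [e] at this
          simpa [szgA] using this
        · intro h
          obtain ⟨l, hl⟩ := szg_sin_zero h
          exact hk0 (I1 k l hl)
        · intro h
          obtain ⟨l, hl⟩ := szg_cos_zero h
          exact I2 k l hl
    · have hk0 := ((hS2 k).1 hk).1
      have hk0' : (k : ℂ) ≠ 0 := by exact_mod_cast hk0
      change Tendsto (fun w => (w - (k:ℂ) / μ) * szgG μ z w) (𝓝[≠] ((k:ℂ) / μ))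
        (𝓝 (-(μ / π) * (szgA u k : ℂ)))
      have hp0 : (k:ℂ) / μ ≠ 0 := div_ne_zero hk0' hμ0'
      have := szg_G_of_F _ _ _ _ hp0 (szg_F_res2 μ z ((k:ℂ) / μ) hμ0' hp0 ?_ ?_ ?_)
      · have e : Complex.cos (π * (z * ((k:ℂ) / μ))) = ((Real.cos (π * (u * k)) : ℝ) : ℂ) := by
          have e1 : (z:ℂ) * ((k:ℂ) / μ) = (u + 2 * (-j : ℤ)) * k := by
            rw [hzμ']; field_simp; push_cast; ring
          rw [e1, szg_cos_shift]
        rw [e] at this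
        convert this using 2
        simp only [szgA]
        push_cast
        generalize Complex.cos _ = X
        rw [div_pow]
        field_simp
      · intro h
        obtain ⟨l, hl⟩ := szg_sin_zero h
        have h1 : (μ : ℂ) * l = k := by rw [← hl, q2]
        have h2 := I1 l k h1
        rw [h2] at h1
        simp at h1
        exact hk0' h1.symm
      · rw [q2]; exact szg_sin_int k
      · intro h
        obtain ⟨l, hl⟩ := szg_cos_zero h
        exact I3 _ k l (q2 k) hl
    · change Tendsto (fun w => (w - ((k:ℂ) + 1 / 2) / z) * szgG μ z w) (𝓝[≠] (((k:ℂ) + 1 / 2) / z))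
        (𝓝 0)
      have hp0 : ((k:ℂ) + 1 / 2) / z ≠ 0 := by
        intro h
        exact I2 0 k (by rw [← q3 k, h]; simp)
      refine szg_G_of_F _ _ _ _ hp0 (szg_F_res3 μ z _ hz0' hp0 (n * (2 * k + 1)) ?_ ?_ ?_ ?_)
      · have := q3 k
        rw [hμ']; push_cast; linear_combination 2 * n * this
      · intro h
        obtain ⟨l, hl⟩ := szg_sin_zero h
        exact I2 l k (by rw [← hl, q3])
      · intro h
        obtain ⟨l, hl⟩ := szg_sin_zero h
        exact I3 _ l k hl (q3 k)
      · rw [q3]; exact szg_cos_half k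

theorem szg_F_bound (μ z R δ : ℝ) (hR : 0 < R) (hδ : 0 < δ) (hR1 : ∀ k : ℤ, δ ≤ |R * 1 - 0 - k|)
    (hR2 : ∀ k : ℤ, δ ≤ |R * |μ| - 0 - k|) (hR3 : ∀ k : ℤ, δ ≤ |R * |z| - 1 / 2 - k|)
    (w : ℂ) (hw : ‖w‖ = R) :
    ‖szgF μ z w‖ ≤ 2 * (1 + 1 / δ) * (1 / δ) / R ^ 2 := by
  have b1 := szg_cot_bound w δ hδ (by
    intro k
    have h1 := abs_norm_sub_norm_le w (k : ℂ)
    rw [hw, Complex.norm_intCast] at h1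
    have h2 := hR1 |k|
    push_cast at h2
    rw [mul_one, sub_zero] at h2
    linarith)
  have b2 := szg_cot_bound (μ * w) δ hδ (by
    intro k
    have h1 := abs_norm_sub_norm_le (μ * w) (k : ℂ)
    rw [norm_mul, hw, Complex.norm_intCast, Complex.norm_real, Real.norm_eq_abs] at h1
    have h2 := hR2 |k|
    push_cast at h2
    rw [mul_comm, sub_zero] at h2
    linarith)
  have b3 := szg_sec_bound (z * w) δ hδ (by
    intro k
    have h1 := abs_norm_sub_norm_le (z * w) (((k : ℝ) - 1 / 2 : ℝ) : ℂ)
    rw [norm_mul, hw, Complex.norm_real, Complex.norm_real, Real.norm_eq_abs, Real.norm_eq_abs] at h1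
    have e : (z:ℂ) * w + 1 / 2 - k = z * w - (((k : ℝ) - 1 / 2 : ℝ) : ℂ) := by push_cast; ring
    rw [e]
    refine le_trans ?_ h1
    rcases abs_choice ((k:ℝ) - 1 / 2) with h5 | h5
    · rw [h5]
      have := hR3 (k - 1)
      push_cast at this
      refine this.trans (le_of_eq ?_)
      congr 1; ring
    · rw [h5]
      have := hR3 (-k)
      push_cast at this
      refine this.trans (le_of_eq ?_)
      congr 1; ring)
  unfold szgF
  rw [norm_mul, norm_div, norm_pow, hw]
  have b4 : ‖Complex.cot (π * w) - Complex.cot (π * (μ * w))‖ ≤ 2 * (1 + 1 / δ) :=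
    (norm_sub_le _ _).trans (by linarith)
  calc _ ≤ 2 * (1 + 1 / δ) / R ^ 2 * (1 / δ) := by gcongr
    _ = _ := by ring

open Filter Topology in
theorem szg_main (u : ℝ) (hu : Irrational u) (j n : ℤ) (hn : n ≠ 0) (z μ : ℝ)
    (hz : z = u + 2 * j) (hμ : μ = 2 * n * z + 1) (hzμ : z = μ * (u - 2 * j))
    (A : ℝ) (hA : HasSum (szgA u) A) :
    (π * z ^ 2 / 2 * (1 - 1 / μ) - π / 3 * (1 - μ)) + 1 / π * A - μ / π * A = 0 := by
  have hzirr : Irrational z := by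
    rw [hz]
    have := hu.add_intCast (2 * j)
    push_cast at this; exact this
  have hz0 : z ≠ 0 := hzirr.ne_zero
  have hμ0 : μ ≠ 0 := by
    rintro rfl
    rw [zero_mul] at hzμ
    exact hz0 hzμ
  obtain ⟨δ, hδ, hrad⟩ := szg_radius ![1, |μ|, |z|] ![0, 0, 1 / 2] (by
    intro i
    fin_cases i <;> simp [hμ0, hz0])
  choose r hr1 hr2 using hrad
  let ρ : ℕ → ℝ := fun K => r (K + 1)
  have hρ1 : ∀ K : ℕ, (K : ℝ) + 1 ≤ ρ K := fun K => hr1 _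
  have hρ0 : ∀ K : ℕ, 0 < ρ K := fun K => lt_of_lt_of_le (by positivity) (hρ1 K)
  have g1 : ∀ K, ∀ k : ℤ, δ ≤ |ρ K * 1 - 0 - k| := fun K k => hr2 (K + 1) 0 k
  have g2 : ∀ K, ∀ k : ℤ, δ ≤ |ρ K * |μ| - 0 - k| := fun K k => hr2 (K + 1) 1 k
  have g3 : ∀ K, ∀ k : ℤ, δ ≤ |ρ K * |z| - 1 / 2 - k| := fun K k => hr2 (K + 1) 2 k
  have hne : ∀ y : ℝ, δ ≤ |y| → y ≠ 0 := by
    rintro y hy rfl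
    rw [abs_zero] at hy; linarith
  have hρtop : Tendsto ρ atTop atTop :=
    tendsto_atTop_mono (fun K => (le_trans (by linarith) (hρ1 K) : (K:ℝ) ≤ ρ K))
      tendsto_natCast_atTop_atTop
  have hcontour := fun K => szg_contour u hu j n hn z μ hz hμ hzμ (ρ K) (hρ0 K)
    (fun k => hne _ (g1 K k)) (fun k => hne _ (g2 K k)) (fun k => hne _ (g3 K k))
  have hzero : Tendsto (fun K => ∮ w in C(0, ρ K), szgF μ z w) atTop (𝓝 0) := by
    have hb : ∀ K, ‖∮ w in C(0, ρ K), szgF μ z w‖ ≤ 2 * π * (2 * (1 + 1 / δ) * (1 / δ)) / ρ K := by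
      intro K
      have h0 := hρ0 K
      have := circleIntegral.norm_integral_le_of_norm_le_const (c := 0) (f := szgF μ z) (hρ0 K).le
        (fun w hw => szg_F_bound μ z (ρ K) δ (hρ0 K) hδ (g1 K) (g2 K) (g3 K) w (by simpa using hw))
      refine this.trans (le_of_eq ?_)
      field_simp
    refine squeeze_zero_norm hb ?_
    exact tendsto_const_nhds.div_atTop hρtop
  have hAc : HasSum (fun k => (szgA u k : ℂ)) (A : ℂ) := by exact_mod_cast hA
  have hAt : Tendsto (fun s : Finset ℤ => ∑ k ∈ s, (szgA u k : ℂ)) atTop (𝓝 (A : ℂ)) := by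
    simpa [HasSum] using hAc
  have s1 : Tendsto (fun K => ∑ k ∈ szgT (ρ K), (szgA u k : ℂ)) atTop (𝓝 (A : ℂ)) :=
    hAt.comp (szg_T_tendsto.comp hρtop)
  have s2 : Tendsto (fun K => ∑ k ∈ szgT (|μ| * ρ K), (szgA u k : ℂ)) atTop (𝓝 (A : ℂ)) :=
    hAt.comp (szg_T_tendsto.comp (hρtop.const_mul_atTop (abs_pos.2 hμ0)))
  have hlim := (((tendsto_const_nhds (x := ((π:ℂ) * z ^ 2 / 2 * (1 - 1 / μ) - π / 3 * (1 - μ)))).add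
    (s1.const_mul (1 / (π:ℂ)))).sub (s2.const_mul ((μ:ℂ) / π))).const_mul (2 * π * Complex.I)
  have heq := tendsto_nhds_unique hzero (hlim.congr (fun K => (hcontour K).symm))
  have hne2 : (2 * π * Complex.I : ℂ) ≠ 0 := Complex.two_pi_I_ne_zero
  have := (mul_eq_zero.1 heq.symm).resolve_left hne2
  exact_mod_cast this

theorem secant_zeta_two_general (j n : ℤ) (hn : n ≠ 0)
    (hpos : 0 < (2 * j * (2 * j * n + 1) : ℝ) / n)
    (hirr : Irrational (Real.sqrt ((2 * j * (2 * j * n + 1) : ℝ) / n))) :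
    ∑' m : ℕ, 1 / Real.cos (π * (m + 1) * Real.sqrt ((2 * j * (2 * j * n + 1) : ℝ) / n)) /
        ((m : ℝ) + 1) ^ 2 =
      (1 + 3 * (j : ℝ) / n) * π ^ 2 / 6 := by
  have hsq := Real.sq_sqrt hpos.le
  have hupos := Real.sqrt_pos.2 hpos
  set u := Real.sqrt ((2 * j * (2 * j * n + 1) : ℝ) / n) with hu
  have hn' : (n : ℝ) ≠ 0 := by exact_mod_cast hn
  have hpi := Real.pi_ne_zero
  have hN : (n : ℝ) * u ^ 2 = ((2 * j * (2 * j * n + 1) : ℤ) : ℝ) := by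
    rw [hsq]; push_cast; field_simp
  have hs := (szg_summable u hupos hirr n _ hn hN).hasSum
  set ψ := ∑' m : ℕ, 1 / Real.cos (π * (m + 1) * u) / ((m : ℝ) + 1) ^ 2 with hψ
  have h1 : HasSum (fun m : ℕ => szgA u ((m : ℤ) + 1)) ψ := by
    convert hs using 2 with m
    simp only [szgA]
    push_cast
    rw [show π * (u * ((m:ℝ) + 1)) = π * ((m:ℝ) + 1) * u by ring, one_div]
  have h2 : HasSum (fun m : ℕ => szgA u (-((m : ℤ) + 1))) ψ := by
    convert hs using 2 with m
    simp only [szgA]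
    push_cast
    rw [show π * (u * -((m:ℝ) + 1)) = -(π * ((m:ℝ) + 1) * u) by ring, Real.cos_neg, one_div, neg_sq]
  have hA := HasSum.of_add_one_of_neg_add_one h1 h2
  have h0 : szgA u 0 = 0 := by simp [szgA]
  rw [h0, add_zero] at hA
  set z := u + 2 * j with hz
  set μ := 2 * n * z + 1 with hμ
  have hzμ : z = μ * (u - 2 * j) := by
    have : (n : ℝ) * u ^ 2 = 2 * j * (2 * j * n + 1) := by rw [hN]; push_cast; ring
    rw [hμ, hz]; linear_combination (-2) * this
  have hzirr : Irrational z := by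
    rw [hz]
    have := hirr.add_intCast (2 * j)
    push_cast at this; exact this
  have hz0 : z ≠ 0 := hzirr.ne_zero
  have hμ0 : μ ≠ 0 := by
    intro h
    rw [h, zero_mul] at hzμ
    exact hz0 hzμ
  have key := szg_main u hirr j n hn z μ hz hμ hzμ (ψ + ψ) hA
  have hμ1 : μ - 1 ≠ 0 := by
    rw [hμ]; simp [hn, hz0]
  have hzz : z ^ 2 / μ = 2 * j / n := by
    rw [div_eq_div_iff hμ0 hn']
    have : (n : ℝ) * u ^ 2 = 2 * j * (2 * j * n + 1) := by rw [hN]; push_cast; ring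
    have e : z ^ 2 = z * (μ * (u - 2 * j)) := by rw [← hzμ]; ring
    rw [e, hz]; linear_combination μ * this
  have key2 : (μ - 1) * (π / 2 * (z ^ 2 / μ) + π / 3 - 2 / π * ψ) = 0 := by
    rw [← key]; field_simp; ring
  have key3 := (mul_eq_zero.1 key2).resolve_left hμ1
  rw [hzz] at key3
  have : ψ = π / 2 * (π / 2 * (2 * j / n) + π / 3) := by
    have h5 : π / 2 * (2 / π * ψ) = ψ := by field_simp
    rw [← h5]; congr 1; linarith
  rw [this]; field_simp; ring
end
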